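/- arXiv:1012.0671 — 2 statements merged into one kernel-verified Lean document; each statement's English description precedes it below -/
import Mathlib

section
/- Fix an integer t ≥ 2. Then lim_{n→∞} R_t(N_n) = e^γ / ζ(t), where R_t(x) := Ψ_t(x)/(x log log x), γ is the Euler–Mascheroni constant and ζ is the Riemann zeta function. -/
open Finset Filter

/-- Generalized Dedekind psi function `Ψ_t(n) = n ∏_{p ∣ n} (1 + 1/p + ⋯ + 1/p^(t-1))`. -/
noncomputable def Psi (t n : ℕ) : ℝ :=
  (n : ℝ) * ∏ p ∈ n.primeFactors, ∑ i ∈ Finset.range t, (1 : ℝ) / (p : ℝ) ^ i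

/-- The primorial `N_n = ∏_{k=1}^n p_k`, the product of the first `n` primes. -/
noncomputable def primorialAt (n : ℕ) : ℕ := ∏ k ∈ Finset.range n, Nat.nth Nat.Prime k

/-- The `n`-th prime `p_n` (so `nthPrime 1 = 2`). -/
noncomputable def nthPrime (n : ℕ) : ℕ := Nat.nth Nat.Prime (n - 1)

/-- The ratio `R_t(x) = Ψ_t(x) / (x log log x)`. -/
noncomputable def Rt (t n : ℕ) : ℝ := Psi t n / ((n : ℝ) * Real.log (Real.log n))

/-- The Riemann zeta value `ζ(t) = ∑_{n ≥ 1} n^{-t}` at an integer argument. -/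
noncomputable def zetaNat (t : ℕ) : ℝ := ∑' k : ℕ, 1 / ((k : ℝ) + 1) ^ t

/-- `log n!` decomposed over the primes up to `n`. -/
lemma log_factorial_eq_sum_primesBelow (n : ℕ) :
    Real.log n.factorial =
      ∑ p ∈ (n + 1).primesBelow, (n.factorial.factorization p : ℝ) * Real.log p := by
  rw [Real.log_nat_eq_sum_factorization, Finsupp.sum_of_support_subset]
  · intro p hp
    rw [Nat.support_factorization, Nat.mem_primeFactors] at hp
    exact Nat.mem_primesBelow.2 ⟨Nat.lt_succ_of_le ((hp.1.dvd_factorial).1 hp.2.1), hp.1⟩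
  · simp

lemma div_sub_one_le_factorization_factorial {p : ℕ} (hp : p.Prime) (n : ℕ) :
    (n : ℝ) / p - 1 ≤ n.factorial.factorization p := by
  have h : n / p ≤ n.factorial.factorization p := by
    rw [Nat.factorization_factorial hp (show Nat.log p n < Nat.log p n + 2 by omega)]
    calc n / p = n / p ^ 1 := by rw [pow_one]
      _ ≤ _ := Finset.single_le_sum (f := fun i => n / p ^ i) (fun _ _ => Nat.zero_le _)
        (by simp)
  have h2 := Nat.lt_floor_add_one ((n : ℝ) / p)
  rw [Nat.floor_div_eq_div] at h2
  have h3 : ((n / p : ℕ) : ℝ) ≤ n.factorial.factorization p := by exact_mod_cast h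
  linarith

lemma factorization_factorial_le_div {p : ℕ} (hp : p.Prime) (n : ℕ) :
    (n.factorial.factorization p : ℝ) ≤ n / p + n / (p * (p - 1)) := by
  have h : (n.factorial.factorization p : ℝ) ≤ (n / (p - 1) : ℕ) := by
    exact_mod_cast Nat.factorization_factorial_le_div_pred hp n
  have h1 : ((n / (p - 1) : ℕ) : ℝ) ≤ n / ((p - 1 : ℕ) : ℝ) := Nat.cast_div_le
  have h2 : (1 : ℝ) < p := by exact_mod_cast hp.one_lt
  rw [Nat.cast_sub hp.one_le, Nat.cast_one] at h1
  have h3 : (n : ℝ) / p + n / (p * (p - 1)) = n / (p - 1) := by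
    have : (p : ℝ) - 1 ≠ 0 := by linarith
    field_simp
    ring
  linarith

lemma summable_log_div_mul_sub_one :
    Summable fun n : ℕ => Real.log n / ((n : ℝ) * (n - 1)) := by
  refine Summable.of_nonneg_of_le (fun n => ?_) (fun n => ?_)
    ((Real.summable_nat_rpow (p := -(3 / 2))).2 (by norm_num) |>.mul_left 4)
  · rcases Nat.eq_zero_or_pos n with rfl | hn
    · simp
    · have : (1 : ℝ) ≤ n := by exact_mod_cast hn
      have := Real.log_nonneg this
      have : (0 : ℝ) ≤ n - 1 := by linarith
      positivity
  · rcases Nat.lt_or_ge n 2 with hn | hn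
    · interval_cases n <;> simp
    · have h2 : (2 : ℝ) ≤ n := by exact_mod_cast hn
      have h0 : (0 : ℝ) < n := by linarith
      have hl := Real.log_le_rpow_div h0.le (show (0 : ℝ) < 1 / 2 by norm_num)
      have e : (n : ℝ) ^ (-(3 / 2) : ℝ) * (n * n) = (n : ℝ) ^ (1 / 2 : ℝ) := by
        rw [← pow_two, ← Real.rpow_natCast, ← Real.rpow_add h0]
        norm_num
      have hp : (0 : ℝ) < (n : ℝ) ^ (-(3 / 2) : ℝ) := by positivity
      rw [div_le_iff₀ (by nlinarith)]
      calc Real.log n ≤ (n : ℝ) ^ (1 / 2 : ℝ) / (1 / 2) := hl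
        _ = (n : ℝ) ^ (-(3 / 2) : ℝ) * (2 * (n * n)) := by rw [← e]; ring
        _ ≤ (n : ℝ) ^ (-(3 / 2) : ℝ) * (4 * (n * (n - 1))) := by
          gcongr ?_ * ?_
          nlinarith
        _ = _ := by ring

/-- Mertens' first theorem: `∑_{p ≤ n} log p / p = log n + O(1)`. -/
lemma exists_abs_sum_log_div_sub_log_le :
    ∃ K : ℝ, ∀ n : ℕ, 1 ≤ n →
      |∑ p ∈ (n + 1).primesBelow, Real.log p / p - Real.log n| ≤ K := by
  set M := ∑' n : ℕ, Real.log n / ((n : ℝ) * (n - 1))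
  refine ⟨max (Real.log 4) (1 + M), fun n hn => ?_⟩
  have hn0 : (0 : ℝ) < n := by exact_mod_cast hn
  have hn1 : (1 : ℝ) ≤ n := by exact_mod_cast hn
  have hfac := log_factorial_eq_sum_primesBelow n
  have hlog : ∀ p ∈ (n + 1).primesBelow, 0 ≤ Real.log p := fun p _ => Real.log_natCast_nonneg p
  rw [abs_le]
  constructor
  · have hup : Real.log n.factorial ≤
        n * ∑ p ∈ (n + 1).primesBelow, Real.log p / p + n * M := by
      calc Real.log n.factorial
          ≤ ∑ p ∈ (n + 1).primesBelow,
              ((n : ℝ) / p + n / (p * (p - 1))) * Real.log p := by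
            rw [hfac]
            refine Finset.sum_le_sum fun p hp => ?_
            exact mul_le_mul_of_nonneg_right
              (factorization_factorial_le_div (Nat.prime_of_mem_primesBelow hp) n) (hlog p hp)
        _ = n * ∑ p ∈ (n + 1).primesBelow, Real.log p / p
              + n * ∑ p ∈ (n + 1).primesBelow, Real.log p / ((p : ℝ) * (p - 1)) := by
            rw [Finset.mul_sum, Finset.mul_sum, ← Finset.sum_add_distrib]
            exact Finset.sum_congr rfl fun p _ => by ring
        _ ≤ _ := by
            gcongr
            refine summable_log_div_mul_sub_one.sum_le_tsum _ fun i _ => ?_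
            rcases Nat.eq_zero_or_pos i with rfl | hi
            · simp
            · have h1 : (1 : ℝ) ≤ i := by exact_mod_cast hi
              have := Real.log_nonneg h1
              have : (0 : ℝ) ≤ i - 1 := by linarith
              positivity
    have hst := Stirling.le_log_factorial_stirling (n := n) (by omega)
    have h2 : 0 ≤ Real.log (2 * Real.pi) :=
      Real.log_nonneg (by nlinarith [Real.pi_gt_three])
    have h3 : 0 ≤ Real.log n := Real.log_nonneg hn1
    have h4 : n * Real.log n ≤
        n * (∑ p ∈ (n + 1).primesBelow, Real.log p / p + M + 1) := by
      linarith
    have := le_of_mul_le_mul_left h4 hn0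
    linarith [le_max_right (Real.log 4) (1 + M)]
  · have hlow : n * ∑ p ∈ (n + 1).primesBelow, Real.log p / p - Chebyshev.theta n ≤
        Real.log n.factorial := by
      rw [Chebyshev.theta_eq_sum_primesLE_log, hfac, Finset.mul_sum, Nat.primesLE,
        ← Finset.sum_sub_distrib]
      refine Finset.sum_le_sum fun p hp => ?_
      calc n * (Real.log p / p) - Real.log p = ((n : ℝ) / p - 1) * Real.log p := by ring
        _ ≤ _ := mul_le_mul_of_nonneg_right
              (div_sub_one_le_factorization_factorial (Nat.prime_of_mem_primesBelow hp) n)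
              (hlog p hp)
    have hth := Chebyshev.theta_le_log4_mul_x hn0.le
    have hf : Real.log n.factorial ≤ n * Real.log n := by
      rw [← Real.log_pow]
      exact Real.log_le_log (by positivity) (by exact_mod_cast Nat.factorial_le_pow n)
    have h4 : n * (∑ p ∈ (n + 1).primesBelow, Real.log p / p) ≤
        n * (Real.log n + Real.log 4) := by
      linarith
    have := le_of_mul_le_mul_left h4 hn0
    linarith [le_max_left (Real.log 4) (1 + M)]

lemma exists_abs_sum_primesBelow_log_div_sub_log_le :
    ∃ K : ℝ, ∀ n : ℕ, 1 ≤ n → |∑ p ∈ n.primesBelow, Real.log p / p - Real.log n| ≤ K := by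
  obtain ⟨K, hK⟩ := exists_abs_sum_log_div_sub_log_le
  have hK0 : 0 ≤ K := (abs_nonneg _).trans (hK 1 le_rfl)
  refine ⟨K + 1, fun n hn => ?_⟩
  obtain ⟨m, rfl⟩ : ∃ m, n = m + 1 := ⟨n - 1, by omega⟩
  rcases Nat.eq_zero_or_pos m with rfl | hm
  · simp; linarith
  have hm1 : (1 : ℝ) ≤ m := by exact_mod_cast hm
  have h1 : Real.log m ≤ Real.log ((m + 1 : ℕ) : ℝ) :=
    Real.log_le_log (by linarith) (by push_cast; linarith)
  have h2 : Real.log ((m + 1 : ℕ) : ℝ) ≤ Real.log m + 1 := by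
    rw [← sub_le_iff_le_add', ← Real.log_div (by positivity) (by positivity)]
    refine (Real.log_le_sub_one_of_pos (by positivity)).trans ?_
    rw [sub_le_iff_le_add, div_le_iff₀ (by linarith)]
    push_cast; linarith
  have := abs_le.1 (hK m hm)
  rw [abs_le]
  constructor <;> linarith

/-- Mertens' second theorem, with an unspecified constant. -/
lemma exists_tendsto_sum_primesBelow_inv_sub_log_log :
    ∃ C : ℝ, Tendsto (fun n : ℕ => ∑ p ∈ n.primesBelow, (p : ℝ)⁻¹ - Real.log (Real.log n))
      atTop (nhds C) := by
  obtain ⟨K, hK⟩ := exists_abs_sum_primesBelow_log_div_sub_log_le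
  set S : ℕ → ℝ := fun n => ∑ p ∈ n.primesBelow, Real.log p / p with hS
  set f : ℕ → ℝ := fun n => ∑ p ∈ n.primesBelow, (p : ℝ)⁻¹ with hf
  set E : ℕ → ℝ := fun n => S n - Real.log n with hE
  set T : ℕ → ℝ := fun n => f n - Real.log (Real.log n) - E n / Real.log n with hT
  have hlogpos : ∀ n : ℕ, 2 ≤ n → 0 < Real.log n := fun n hn =>
    Real.log_pos (by exact_mod_cast hn)
  have hlogmono : ∀ n : ℕ, 2 ≤ n → Real.log n ≤ Real.log (n + 1 : ℕ) := fun n hn =>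
    Real.log_le_log (by positivity) (by push_cast; linarith)
  have hinv : ∀ n : ℕ, 2 ≤ n → 0 ≤ (Real.log n)⁻¹ - (Real.log (n + 1 : ℕ))⁻¹ := fun n hn =>
    sub_nonneg.2 (inv_anti₀ (hlogpos n hn) (hlogmono n hn))
  have hstep : ∀ n : ℕ, 2 ≤ n →
      |T (n + 1) - T n| ≤ (K + 1) * ((Real.log n)⁻¹ - (Real.log (n + 1 : ℕ))⁻¹) := by
    intro n hn
    have hfS : f (n + 1) - f n = (S (n + 1) - S n) / Real.log n := by
      have hl := (hlogpos n hn).ne'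
      simp only [hf, hS, Nat.primesBelow_succ]
      split_ifs with hp
      · rw [Finset.sum_insert (Nat.notMem_primesBelow n),
          Finset.sum_insert (Nat.notMem_primesBelow n)]
        have : (n : ℝ) ≠ 0 := by positivity
        field_simp
        ring
      · simp
    have ha := hlogpos n hn
    have hab := hlogmono n hn
    have hb := ha.trans_le hab
    have hEn := hK (n + 1) (by omega)
    have hba : Real.log (n + 1 : ℕ) - Real.log n ≤ 1 := by
      have : (2 : ℝ) ≤ n := by exact_mod_cast hn
      rw [← Real.log_div (by positivity) (by positivity)]
      refine (Real.log_le_sub_one_of_pos (by positivity)).trans ?_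
      rw [sub_le_iff_le_add, div_le_iff₀ (by linarith)]
      push_cast; linarith
    have hid : T (n + 1) - T n = ((Real.log (n + 1 : ℕ) - Real.log n) / Real.log n
        - (Real.log (Real.log (n + 1 : ℕ)) - Real.log (Real.log n)))
        + E (n + 1) * ((Real.log n)⁻¹ - (Real.log (n + 1 : ℕ))⁻¹) := by
      have : f (n + 1) = f n + (S (n + 1) - S n) / Real.log n := by linarith
      simp only [hT, hE, this]
      field_simp
      ring
    rw [hid]
    have hd := hinv n hn
    change |E (n + 1)| ≤ K at hEn
    generalize Real.log (n + 1 : ℕ) = b at *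
    generalize Real.log n = a at *
    have hll : Real.log b - Real.log a = Real.log (b / a) := (Real.log_div hb.ne' ha.ne').symm
    have h1 : Real.log (b / a) ≤ b / a - 1 := Real.log_le_sub_one_of_pos (by positivity)
    have h2 : 1 - (b / a)⁻¹ ≤ Real.log (b / a) := Real.one_sub_inv_le_log_of_pos (by positivity)
    have h3 : b / a - 1 = (b - a) / a := by field_simp
    have h4 : 1 - (b / a)⁻¹ = (b - a) / b := by field_simp
    rw [hll]
    refine (abs_add_le _ _).trans ?_
    rw [abs_mul, abs_of_nonneg hd, add_mul, add_comm, one_mul]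
    refine add_le_add (mul_le_mul_of_nonneg_right hEn hd) ?_
    rw [abs_of_nonneg (by linarith)]
    calc (b - a) / a - Real.log (b / a) ≤ (b - a) / a - (b - a) / b := by linarith
      _ = (b - a) * (a⁻¹ - b⁻¹) := by ring
      _ ≤ 1 * (a⁻¹ - b⁻¹) := by gcongr
      _ = _ := one_mul _
  have hcau : CauchySeq fun n => T (n + 2) := by
    refine cauchySeq_of_dist_le_of_summable
      (fun n => (K + 1) * ((Real.log (n + 2 : ℕ))⁻¹ - (Real.log (n + 2 + 1 : ℕ))⁻¹)) ?_ ?_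
    · intro n
      rw [dist_comm, Real.dist_eq]
      exact hstep (n + 2) (by omega)
    · refine Summable.mul_left _ (summable_of_sum_range_le (c := (Real.log (2 : ℕ))⁻¹)
        (fun n => hinv (n + 2) (by omega)) fun n => ?_)
      have := Finset.sum_range_sub' (fun n : ℕ => (Real.log (n + 2 : ℕ))⁻¹) n
      simp only [zero_add] at this
      have e : ∀ i : ℕ, i + 1 + 2 = i + 2 + 1 := fun i => by omega
      simp only [e] at this
      rw [this]
      exact sub_le_self _ (inv_nonneg.2 (hlogpos (n + 2) (by omega)).le)
  obtain ⟨C, hC⟩ := cauchySeq_tendsto_of_complete hcau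
  refine ⟨C, ?_⟩
  have hC' := (tendsto_add_atTop_iff_nat 2).1 hC
  have hE0 : Tendsto (fun n : ℕ => E n / Real.log n) atTop (nhds 0) := by
    have hl : Tendsto (fun n : ℕ => K / Real.log n) atTop (nhds 0) :=
      tendsto_const_nhds.div_atTop (Real.tendsto_log_atTop.comp tendsto_natCast_atTop_atTop)
    refine squeeze_zero_norm' ?_ hl
    filter_upwards [eventually_ge_atTop 2] with n hn
    rw [norm_div, Real.norm_eq_abs, Real.norm_eq_abs, abs_of_pos (hlogpos n hn)]
    exact div_le_div_of_nonneg_right (hK n (by omega)) (hlogpos n hn).le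
  simpa [hT] using hC'.add hE0

/-- The tail `-log (1 - x) - x = x² / 2 + x³ / 3 + ⋯`. -/
noncomputable def logTail (x : ℝ) : ℝ := -Real.log (1 - x) - x

lemma abs_logTail_le {x : ℝ} (h0 : 0 ≤ x) (h1 : x ≤ 1 / 2) : |logTail x| ≤ 2 * x ^ 2 := by
  have h := Real.abs_log_sub_add_sum_range_le (x := x) (by rw [abs_of_nonneg h0]; linarith) 1
  simp only [Finset.sum_range_one, Nat.cast_zero, zero_add, pow_one, div_one, abs_of_nonneg h0]
    at h
  rw [logTail, ← abs_neg, show -(-Real.log (1 - x) - x) = x + Real.log (1 - x) by ring]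
  refine h.trans ?_
  rw [div_le_iff₀ (by linarith), one_add_one_eq_two]
  nlinarith [mul_nonneg (sq_nonneg x) (by linarith : 0 ≤ 1 - 2 * x)]

/-- `n ^ (-s)` on primes, `0` elsewhere. -/
noncomputable def primeRpow (s : ℝ) (n : ℕ) : ℝ := if n.Prime then (n : ℝ) ^ (-s) else 0

lemma primeRpow_nonneg (s : ℝ) (n : ℕ) : 0 ≤ primeRpow s n := by
  unfold primeRpow; split_ifs <;> positivity

lemma primeRpow_le {s : ℝ} (n : ℕ) : primeRpow s n ≤ (n : ℝ) ^ (-s) := by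
  unfold primeRpow; split_ifs
  · rfl
  · positivity

lemma primeRpow_anti {s r : ℝ} (h : r ≤ s) (n : ℕ) : primeRpow s n ≤ primeRpow r n := by
  unfold primeRpow
  split_ifs with hn
  · exact Real.rpow_le_rpow_of_exponent_le (by exact_mod_cast hn.one_le) (by linarith)
  · rfl

lemma primeRpow_le_half {s : ℝ} (hs : 1 ≤ s) (n : ℕ) : primeRpow s n ≤ 1 / 2 := by
  refine (primeRpow_anti hs n).trans ?_
  unfold primeRpow
  split_ifs with hn
  · rw [Real.rpow_neg_one, one_div]
    exact inv_anti₀ two_pos (by exact_mod_cast hn.two_le)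
  · norm_num

lemma summable_primeRpow {s : ℝ} (hs : 1 < s) : Summable (primeRpow s) :=
  Summable.of_nonneg_of_le (primeRpow_nonneg s) (primeRpow_le)
    (Real.summable_nat_rpow.2 (by linarith))

lemma norm_logTail_primeRpow_le {s : ℝ} (hs : 1 ≤ s) (n : ℕ) :
    ‖logTail (primeRpow s n)‖ ≤ 2 * (n : ℝ) ^ (-2 : ℝ) := by
  refine (abs_logTail_le (primeRpow_nonneg s n) (primeRpow_le_half hs n)).trans ?_
  have h : primeRpow s n ≤ (n : ℝ) ^ (-1 : ℝ) := (primeRpow_anti hs n).trans (primeRpow_le n)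
  have e : (n : ℝ) ^ (-2 : ℝ) = ((n : ℝ) ^ (-1 : ℝ)) ^ 2 := by
    rw [← Real.rpow_natCast, ← Real.rpow_mul n.cast_nonneg]; norm_num
  rw [e]
  have := primeRpow_nonneg s n
  gcongr

lemma summable_two_mul_rpow_neg_two : Summable fun n : ℕ => 2 * (n : ℝ) ^ (-2 : ℝ) :=
  (Real.summable_nat_rpow.2 (by norm_num)).mul_left 2

lemma summable_logTail_primeRpow {s : ℝ} (hs : 1 ≤ s) :
    Summable fun n => logTail (primeRpow s n) :=
  Summable.of_norm_bounded summable_two_mul_rpow_neg_two (norm_logTail_primeRpow_le hs)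

lemma tendsto_tsum_logTail_primeRpow :
    Tendsto (fun s => ∑' n, logTail (primeRpow s n)) (nhdsWithin 1 (Set.Ioi 1))
      (nhds (∑' n, logTail (primeRpow 1 n))) := by
  refine tendsto_tsum_of_dominated_convergence summable_two_mul_rpow_neg_two (fun n => ?_) ?_
  · refine Tendsto.mono_left ?_ nhdsWithin_le_nhds
    by_cases hn : n.Prime
    · have hc : ContinuousAt (fun s : ℝ => primeRpow s n) 1 := by
        simp only [primeRpow, if_pos hn]
        have : (n : ℝ) ≠ 0 := by exact_mod_cast hn.ne_zero
        exact (Real.continuousAt_const_rpow this).comp continuousAt_neg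
      have h1 : 1 - primeRpow 1 n ≠ 0 := by linarith [primeRpow_le_half le_rfl n]
      have : ContinuousAt (fun s : ℝ => logTail (primeRpow s n)) 1 := by
        unfold logTail
        exact ((continuousAt_const.sub hc).log h1).neg.sub hc
      exact this
    · simp [primeRpow, hn]
  · filter_upwards [self_mem_nhdsWithin] with s hs n
    exact norm_logTail_primeRpow_le (le_of_lt hs) n

lemma sum_primesBelow_eq_sum_range (s : ℝ) (g : ℝ → ℝ) (hg : g 0 = 0) (n : ℕ) :
    ∑ p ∈ n.primesBelow, g ((p : ℝ) ^ (-s)) = ∑ k ∈ Finset.range n, g (primeRpow s k) := by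
  rw [Nat.primesBelow, Finset.sum_filter]
  refine Finset.sum_congr rfl fun k _ => ?_
  unfold primeRpow
  split_ifs <;> simp [hg]

/-- The completely multiplicative function `n ↦ n ^ (-s)`. -/
noncomputable def rpowNegHom (s : ℝ) (hs : s ≠ 0) : ℕ →*₀ ℝ where
  toFun n := (n : ℝ) ^ (-s)
  map_zero' := by simp [Real.zero_rpow (neg_ne_zero.2 hs)]
  map_one' := by simp
  map_mul' m n := by
    push_cast
    exact Real.mul_rpow m.cast_nonneg n.cast_nonneg

lemma tendsto_prod_primesBelow_one_sub_rpow_inv {s : ℝ} (hs : 1 < s) :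
    Tendsto (fun n : ℕ => ∏ p ∈ n.primesBelow, (1 - (p : ℝ) ^ (-s))⁻¹) atTop
      (nhds (∑' n : ℕ, (n : ℝ) ^ (-s))) := by
  have hsum : Summable fun n : ℕ => ‖rpowNegHom s (by linarith) n‖ :=
    (Real.summable_nat_rpow.2 (by linarith : -s < -1)).norm
  exact EulerProduct.eulerProduct_completely_multiplicative hsum

lemma tsum_rpow_neg_pos {s : ℝ} (hs : 1 < s) : 0 < ∑' n : ℕ, (n : ℝ) ^ (-s) :=
  (Real.summable_nat_rpow.2 (by linarith)).tsum_pos (fun _ => by positivity) 1 (by simp)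

lemma rpow_neg_lt_one {s : ℝ} (hs : 0 < s) {p : ℕ} (hp : p.Prime) : (p : ℝ) ^ (-s) < 1 :=
  Real.rpow_lt_one_of_one_lt_of_neg (by exact_mod_cast hp.one_lt) (by linarith)

lemma log_prod_primesBelow {s : ℝ} (hs : 0 < s) (n : ℕ) :
    Real.log (∏ p ∈ n.primesBelow, (1 - (p : ℝ) ^ (-s))⁻¹) =
      ∑ k ∈ Finset.range n, primeRpow s k + ∑ k ∈ Finset.range n, logTail (primeRpow s k) := by
  rw [Real.log_prod, ← Finset.sum_add_distrib,
    ← sum_primesBelow_eq_sum_range s (fun x => x + logTail x) (by simp [logTail])]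
  · refine Finset.sum_congr rfl fun p _ => ?_
    rw [Real.log_inv, logTail]
    ring
  · intro p hp
    have := rpow_neg_lt_one hs (Nat.prime_of_mem_primesBelow hp)
    exact inv_ne_zero (by linarith)

lemma log_tsum_rpow_neg {s : ℝ} (hs : 1 < s) :
    Real.log (∑' n : ℕ, (n : ℝ) ^ (-s)) =
      ∑' n, primeRpow s n + ∑' n, logTail (primeRpow s n) := by
  refine tendsto_nhds_unique
    ((tendsto_prod_primesBelow_one_sub_rpow_inv hs).log (tsum_rpow_neg_pos hs).ne') ?_
  simp_rw [log_prod_primesBelow (by linarith : 0 < s)]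
  exact (summable_primeRpow hs).hasSum.tendsto_sum_nat.add
    (summable_logTail_primeRpow hs.le).hasSum.tendsto_sum_nat

/-- As `s → 1⁺`, the prime zeta function is `-log (s - 1) - ∑_p (-log (1 - 1/p) - 1/p) + o(1)`. -/
lemma tendsto_tsum_primeRpow_add_log :
    Tendsto (fun s => ∑' n, primeRpow s n + Real.log (s - 1)) (nhdsWithin 1 (Set.Ioi 1))
      (nhds (-∑' n, logTail (primeRpow 1 n))) := by
  have h := (tendsto_sub_mul_tsum_nat_rpow.log one_ne_zero).sub tendsto_tsum_logTail_primeRpow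
  rw [Real.log_one, zero_sub] at h
  refine h.congr' ?_
  filter_upwards [self_mem_nhdsWithin] with s hs
  have hs' : 1 < s := hs
  have e : ∀ n : ℕ, 1 / (n : ℝ) ^ s = (n : ℝ) ^ (-s) := fun n => by
    rw [Real.rpow_neg n.cast_nonneg, one_div]
  simp_rw [e]
  rw [Real.log_mul (by linarith) (tsum_rpow_neg_pos hs').ne', log_tsum_rpow_neg hs']
  ring

/-- The sum of `n ^ (-s)` over the primes `n` in `[2 ^ j, 2 ^ (j + 1))`. -/
noncomputable def dyadicPrimeSum (s : ℝ) (j : ℕ) : ℝ :=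
  ∑ k ∈ Finset.Ico (2 ^ j) (2 ^ (j + 1)), primeRpow s k

lemma sum_range_dyadicPrimeSum (s : ℝ) (K : ℕ) :
    ∑ j ∈ Finset.range K, dyadicPrimeSum s j = ∑ k ∈ Finset.range (2 ^ K), primeRpow s k := by
  have h : ∀ j, dyadicPrimeSum s j = ∑ k ∈ Finset.range (2 ^ (j + 1)), primeRpow s k
      - ∑ k ∈ Finset.range (2 ^ j), primeRpow s k := fun j =>
    Finset.sum_Ico_eq_sub _ (Nat.pow_le_pow_right two_pos (Nat.le_succ j))
  simp_rw [h]
  rw [Finset.sum_range_sub (fun j => ∑ k ∈ Finset.range (2 ^ j), primeRpow s k)]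
  simp [primeRpow, Nat.not_prime_zero]

lemma dyadicPrimeSum_nonneg (s : ℝ) (j : ℕ) : 0 ≤ dyadicPrimeSum s j :=
  Finset.sum_nonneg fun k _ => primeRpow_nonneg s k

lemma hasSum_dyadicPrimeSum {s : ℝ} (hs : 1 < s) :
    HasSum (dyadicPrimeSum s) (∑' n, primeRpow s n) := by
  rw [hasSum_iff_tendsto_nat_of_nonneg (dyadicPrimeSum_nonneg s)]
  simp_rw [sum_range_dyadicPrimeSum]
  exact (summable_primeRpow hs).hasSum.tendsto_sum_nat.comp
    (tendsto_pow_atTop_atTop_of_one_lt one_lt_two)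

lemma primeRpow_eq_mul (s : ℝ) (k : ℕ) :
    primeRpow s k = primeRpow 1 k * (k : ℝ) ^ (1 - s) := by
  unfold primeRpow
  split_ifs with hk
  · have : (0 : ℝ) < k := by exact_mod_cast hk.pos
    rw [← Real.rpow_add this]
    ring_nf
  · simp

lemma dyadicPrimeSum_le {s : ℝ} (hs : 1 < s) (j : ℕ) :
    dyadicPrimeSum s j ≤ dyadicPrimeSum 1 j * ((2 : ℝ) ^ (1 - s)) ^ j := by
  rw [dyadicPrimeSum, dyadicPrimeSum, Finset.sum_mul]
  refine Finset.sum_le_sum fun k hk => ?_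
  rw [primeRpow_eq_mul s]
  refine mul_le_mul_of_nonneg_left ?_ (primeRpow_nonneg _ _)
  rw [← Real.rpow_natCast, ← Real.rpow_mul two_pos.le, mul_comm, Real.rpow_mul two_pos.le,
    Real.rpow_natCast]
  refine Real.rpow_le_rpow_of_nonpos (by positivity) ?_ (by linarith)
  exact_mod_cast (Finset.mem_Ico.1 hk).1

lemma le_dyadicPrimeSum {s : ℝ} (hs : 1 < s) (j : ℕ) :
    dyadicPrimeSum 1 j * ((2 : ℝ) ^ (1 - s)) ^ (j + 1) ≤ dyadicPrimeSum s j := by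
  rw [dyadicPrimeSum, dyadicPrimeSum, Finset.sum_mul]
  refine Finset.sum_le_sum fun k hk => ?_
  rw [primeRpow_eq_mul s]
  refine mul_le_mul_of_nonneg_left ?_ (primeRpow_nonneg _ _)
  rw [← Real.rpow_natCast, ← Real.rpow_mul two_pos.le, mul_comm, Real.rpow_mul two_pos.le,
    Real.rpow_natCast]
  have h1 := (Finset.mem_Ico.1 hk).1
  have h0 : 0 < k := (pow_pos two_pos j).trans_le h1
  refine Real.rpow_le_rpow_of_nonpos (by exact_mod_cast h0) ?_ (by linarith)
  exact_mod_cast (Finset.mem_Ico.1 hk).2.le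

lemma tendsto_two_rpow_one_sub :
    Tendsto (fun s : ℝ => (2 : ℝ) ^ (1 - s)) (nhdsWithin 1 (Set.Ioi 1))
      (nhdsWithin 1 (Set.Iio 1)) := by
  refine tendsto_nhdsWithin_iff.2 ⟨?_, ?_⟩
  · have h : ContinuousAt (fun s : ℝ => (2 : ℝ) ^ (1 - s)) 1 :=
      (Real.continuousAt_const_rpow two_ne_zero).comp
        (continuousAt_const.sub continuousAt_id)
    have := h.tendsto.mono_left (nhdsWithin_le_nhds (s := Set.Ioi 1))
    simpa using this
  · filter_upwards [self_mem_nhdsWithin] with s hs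
    exact Real.rpow_lt_one_of_one_lt_of_neg one_lt_two (sub_neg.2 hs)

lemma tendsto_log_one_sub_two_rpow_sub_log :
    Tendsto (fun s : ℝ => Real.log (1 - (2 : ℝ) ^ (1 - s)) - Real.log (s - 1))
      (nhdsWithin 1 (Set.Ioi 1)) (nhds (Real.log (Real.log 2))) := by
  have hd : HasDerivAt (fun s : ℝ => -(2 : ℝ) ^ (1 - s)) (Real.log 2) 1 := by
    have h := (((hasDerivAt_id (1 : ℝ)).const_sub 1).const_rpow two_pos).neg
    refine (h.congr_deriv ?_)
    simp
  have hs := (hd.tendsto_slope.mono_left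
    (nhdsWithin_mono 1 (fun s (hs : 1 < s) => (ne_of_gt hs : s ≠ 1)))).log
      (Real.log_pos one_lt_two).ne'
  refine hs.congr' ?_
  filter_upwards [self_mem_nhdsWithin] with s hs
  have h1 : (2 : ℝ) ^ (1 - s) < 1 := Real.rpow_lt_one_of_one_lt_of_neg one_lt_two (sub_neg.2 hs)
  have h2 : 0 < s - 1 := sub_pos.2 hs
  rw [← Real.log_div (by linarith) h2.ne', slope_def_field]
  congr 1
  simp
  ring

/-- An Abelian argument: the constant in Mertens' second theorem governs the behaviour of the
prime zeta function at `1`. -/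
lemma tendsto_tsum_primeRpow_add_log_of_tendsto {C : ℝ}
    (hC : Tendsto (fun n : ℕ => ∑ k ∈ Finset.range n, primeRpow 1 k - Real.log (Real.log n))
      atTop (nhds C)) :
    Tendsto (fun s => ∑' n, primeRpow s n + Real.log (s - 1)) (nhdsWithin 1 (Set.Ioi 1))
      (nhds (C - Real.eulerMascheroniConstant)) := by
  set L := C + Real.log (Real.log 2) - Real.eulerMascheroniConstant with hL
  set c : ℕ → ℝ := fun j => dyadicPrimeSum 1 j - 1 / ((j : ℝ) + 1) with hc
  have hlog2 : 0 < Real.log 2 := Real.log_pos one_lt_two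
  have hpartial : Tendsto (fun K => ∑ j ∈ Finset.range K, c j) atTop (nhds L) := by
    have h1 := hC.comp (tendsto_pow_atTop_atTop_of_one_lt (one_lt_two (α := ℕ)))
    have h2 := (h1.add_const (Real.log (Real.log 2))).sub Real.tendsto_harmonic_sub_log
    refine h2.congr' ?_
    filter_upwards [eventually_ge_atTop 1] with K hK
    have hK0 : (K : ℝ) ≠ 0 := by positivity
    simp only [hc, Finset.sum_sub_distrib, sum_range_dyadicPrimeSum, Function.comp]
    push_cast
    rw [Real.log_pow, Real.log_mul hK0 hlog2.ne', harmonic]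
    push_cast
    simp only [one_div]
    ring
  have hG := (Real.tendsto_tsum_powerSeries_nhdsWithin_lt hpartial).comp tendsto_two_rpow_one_sub
  set x : ℝ → ℝ := fun s => (2 : ℝ) ^ (1 - s) with hx
  set G : ℝ → ℝ := fun s => ∑' j, c j * x s ^ j with hGdef
  set B : ℝ → ℝ := fun s => ∑' n, primeRpow s n with hB
  change Tendsto G _ _ at hG
  have hx1 : Tendsto x (nhdsWithin 1 (Set.Ioi 1)) (nhds 1) :=
    tendsto_two_rpow_one_sub.mono_right nhdsWithin_le_nhds
  have hkey : ∀ s : ℝ, 1 < s → x s * G s ≤ B s + Real.log (1 - x s) ∧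
      B s + Real.log (1 - x s) ≤ G s - (1 - x s) * Real.log (1 - x s) / x s := by
    intro s hs
    have hx0 : 0 < x s := Real.rpow_pos_of_pos two_pos _
    have hxl : x s < 1 := Real.rpow_lt_one_of_one_lt_of_neg one_lt_two (sub_neg.2 hs)
    have hβ := hasSum_dyadicPrimeSum hs
    have hbs : Summable fun j => dyadicPrimeSum 1 j * x s ^ j := by
      refine Summable.of_nonneg_of_le
        (fun j => mul_nonneg (dyadicPrimeSum_nonneg _ _) (by positivity)) (fun j => ?_)
        (hβ.summable.mul_left (x s)⁻¹)
      rw [inv_mul_eq_div, le_div_iff₀ hx0]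
      refine le_trans (le_of_eq ?_) (le_dyadicPrimeSum hs j)
      rw [pow_succ, mul_assoc]
    have hlog : HasSum (fun j : ℕ => 1 / ((j : ℝ) + 1) * x s ^ j)
        (-Real.log (1 - x s) / x s) := by
      have h := (Real.hasSum_pow_div_log_of_abs_lt_one
        (by rwa [abs_of_pos hx0] : |x s| < 1)).div_const (x s)
      have e : (fun j : ℕ => 1 / ((j : ℝ) + 1) * x s ^ j) =
          fun j : ℕ => x s ^ (j + 1) / ((j : ℝ) + 1) / x s := funext fun j => by
        rw [pow_succ]
        field_simp
      rwa [e]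
    set S := ∑' j, dyadicPrimeSum 1 j * x s ^ j with hS
    have hGS : G s = S + Real.log (1 - x s) / x s := by
      have h := (hbs.hasSum.sub hlog).tsum_eq
      simp only [hGdef, hc, sub_mul, h]
      ring
    have hBS : B s ≤ S := hasSum_le (dyadicPrimeSum_le hs) hβ hbs.hasSum
    have hSB : S * x s ≤ B s := by
      refine hasSum_le (fun j => ?_) (hbs.hasSum.mul_right (x s)) hβ
      refine le_trans (le_of_eq ?_) (le_dyadicPrimeSum hs j)
      rw [pow_succ, mul_assoc]
    rw [hGS]
    constructor
    · have : x s * (S + Real.log (1 - x s) / x s) = S * x s + Real.log (1 - x s) := by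
        field_simp
      linarith
    · have : S + Real.log (1 - x s) / x s - (1 - x s) * Real.log (1 - x s) / x s
          = S + Real.log (1 - x s) := by
        field_simp
        ring
      linarith
  have hlow : Tendsto (fun s => x s * G s) (nhdsWithin 1 (Set.Ioi 1)) (nhds L) := by
    simpa using hx1.mul hG
  have hhigh : Tendsto (fun s => G s - (1 - x s) * Real.log (1 - x s) / x s)
      (nhdsWithin 1 (Set.Ioi 1)) (nhds L) := by
    have h1 : Tendsto (fun s => 1 - x s) (nhdsWithin 1 (Set.Ioi 1)) (nhds 0) := by
      simpa using hx1.const_sub 1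
    have h2 := (Real.continuous_mul_log.tendsto 0).comp h1
    simpa using hG.sub (h2.div hx1 one_ne_zero)
  have hmid : Tendsto (fun s => B s + Real.log (1 - x s)) (nhdsWithin 1 (Set.Ioi 1)) (nhds L) := by
    refine tendsto_of_tendsto_of_tendsto_of_le_of_le' hlow hhigh ?_ ?_
    · filter_upwards [self_mem_nhdsWithin] with s hs using (hkey s hs).1
    · filter_upwards [self_mem_nhdsWithin] with s hs using (hkey s hs).2
  have hfin := hmid.sub tendsto_log_one_sub_two_rpow_sub_log
  rw [show L - Real.log (Real.log 2) = C - Real.eulerMascheroniConstant by rw [hL]; ring] at hfin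
  refine hfin.congr fun s => ?_
  simp only [hx]
  ring

/-- Mertens' third theorem, in logarithmic form. -/
lemma tendsto_log_prod_primesBelow_sub_log_log :
    Tendsto (fun n : ℕ => Real.log (∏ p ∈ n.primesBelow, (1 - (p : ℝ)⁻¹)⁻¹)
      - Real.log (Real.log n)) atTop (nhds Real.eulerMascheroniConstant) := by
  obtain ⟨C, hC⟩ := exists_tendsto_sum_primesBelow_inv_sub_log_log
  have hC' : Tendsto (fun n : ℕ => ∑ k ∈ Finset.range n, primeRpow 1 k
      - Real.log (Real.log n)) atTop (nhds C) := by
    refine hC.congr fun n => ?_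
    rw [← sum_primesBelow_eq_sum_range 1 (fun x => x) rfl]
    simp_rw [Real.rpow_neg_one]
  have hconst := tendsto_nhds_unique (tendsto_tsum_primeRpow_add_log_of_tendsto hC')
    tendsto_tsum_primeRpow_add_log
  have h := hC'.add (summable_logTail_primeRpow le_rfl).hasSum.tendsto_sum_nat
  rw [show C + ∑' n, logTail (primeRpow 1 n) = Real.eulerMascheroniConstant by linarith] at h
  refine h.congr fun n => ?_
  have := log_prod_primesBelow one_pos n
  simp_rw [Real.rpow_neg_one] at this
  rw [this]
  ring

/-- Mertens' third theorem. -/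
lemma tendsto_prod_primesBelow_div_log :
    Tendsto (fun n : ℕ => (∏ p ∈ n.primesBelow, (1 - (p : ℝ)⁻¹)⁻¹) / Real.log n) atTop
      (nhds (Real.exp Real.eulerMascheroniConstant)) := by
  refine (tendsto_log_prod_primesBelow_sub_log_log.rexp).congr' ?_
  filter_upwards [eventually_ge_atTop 2] with n hn
  rw [Real.exp_sub, Real.exp_log, Real.exp_log (Real.log_pos (by exact_mod_cast hn))]
  refine Finset.prod_pos fun p hp => inv_pos.2 (sub_pos.2 (inv_lt_one_of_one_lt₀ ?_))
  exact_mod_cast Nat.one_lt_of_mem_primesBelow hp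

lemma eventually_half_mul_le_theta : ∀ᶠ k : ℕ in atTop, (k : ℝ) / 2 ≤ Chebyshev.theta k := by
  have ho := (isLittleO_log_rpow_atTop (show (0 : ℝ) < 1 / 2 by norm_num)).bound
    (show (0 : ℝ) < 1 / 100 by norm_num)
  filter_upwards [tendsto_natCast_atTop_atTop.eventually ho, eventually_ge_atTop 2] with k hk hk2
  have h2 : (2 : ℝ) ≤ k := by exact_mod_cast hk2
  have hl : 0 ≤ Real.log k := Real.log_nonneg (by linarith)
  rw [← Real.sqrt_eq_rpow, Real.norm_of_nonneg hl, Real.norm_of_nonneg (Real.sqrt_nonneg _)] at hk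
  have hsq : √(k : ℝ) * √(k : ℝ) = k := Real.mul_self_sqrt (by linarith)
  have hs1 : 1 ≤ √(k : ℝ) := Real.one_le_sqrt.2 (by linarith)
  have hlog : Real.log (k + 1) ≤ 2 * Real.log k := by
    rw [← Nat.cast_two, ← Real.log_pow]
    exact Real.log_le_log (by linarith) (by nlinarith)
  have hθ := Chebyshev.theta_ge k
  have h3 : √(k : ℝ) * Real.log k ≤ k / 100 := by nlinarith
  nlinarith [Real.log_two_gt_d9]

lemma tendsto_log_sum_log_primesBelow_div_log :
    Tendsto (fun m : ℕ => Real.log (∑ p ∈ m.primesBelow, Real.log p) / Real.log m) atTop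
      (nhds 1) := by
  have hlogm : Tendsto (fun m : ℕ => Real.log m) atTop atTop :=
    Real.tendsto_log_atTop.comp tendsto_natCast_atTop_atTop
  have hbound : ∀ᶠ m : ℕ in atTop,
      Real.log (1 / 4) ≤ Real.log (∑ p ∈ m.primesBelow, Real.log p) - Real.log m ∧
      Real.log (∑ p ∈ m.primesBelow, Real.log p) - Real.log m ≤ Real.log (Real.log 4) := by
    filter_upwards [(tendsto_sub_atTop_nat 1).eventually eventually_half_mul_le_theta,
      eventually_ge_atTop 2] with m hm hm2
    have h4 : 0 < Real.log 4 := Real.log_pos (by norm_num)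
    have hm2' : (2 : ℝ) ≤ m := by exact_mod_cast hm2
    have hup := Chebyshev.theta_le_log4_mul_x (x := ((m - 1 : ℕ) : ℝ)) (by positivity)
    rw [Chebyshev.theta_eq_sum_primesLE_log, ← Nat.primesBelow_eq_primesLE_sub_one] at hm hup
    rw [Nat.cast_sub (by omega), Nat.cast_one] at hm hup
    set V := ∑ p ∈ m.primesBelow, Real.log p
    have hV : 0 < V := by linarith
    rw [← Real.log_div hV.ne' (by positivity)]
    constructor
    · refine Real.log_le_log (by norm_num) ?_
      rw [le_div_iff₀ (by linarith)]
      linarith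
    · refine Real.log_le_log (by positivity) ?_
      rw [div_le_iff₀ (by linarith)]
      linarith
  have h1 : Tendsto (fun m : ℕ =>
      (Real.log (∑ p ∈ m.primesBelow, Real.log p) - Real.log m) / Real.log m) atTop (nhds 0) := by
    refine tendsto_of_tendsto_of_tendsto_of_le_of_le'
      ((tendsto_const_nhds (x := Real.log (1 / 4))).div_atTop hlogm)
      ((tendsto_const_nhds (x := Real.log (Real.log 4))).div_atTop hlogm)
      (hbound.mp ?_) (hbound.mp ?_)
    · filter_upwards [hlogm.eventually_gt_atTop 0] with m hm h
      exact div_le_div_of_nonneg_right h.1 hm.le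
    · filter_upwards [hlogm.eventually_gt_atTop 0] with m hm h
      exact div_le_div_of_nonneg_right h.2 hm.le
  have h2 := h1.add_const 1
  rw [zero_add] at h2
  refine h2.congr' ?_
  filter_upwards [hlogm.eventually_gt_atTop 0] with m hm
  field_simp
  ring

lemma primorialAt_eq_prod_primesBelow (n : ℕ) :
    primorialAt n = ∏ p ∈ (Nat.nth Nat.Prime n).primesBelow, p := by
  induction n with
  | zero => simp [primorialAt, Nat.nth_prime_zero_eq_two]
  | succ n ih =>
    rw [primorialAt, Finset.prod_range_succ, ← primorialAt, ih, Nat.primesBelow, Nat.primesBelow,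
      Nat.filter_range_nth_eq_insert_of_infinite Nat.infinite_setOfPred_prime,
      Finset.prod_insert (by simp), mul_comm]

lemma zetaNat_eq_tsum_rpow_neg {t : ℕ} (ht : 2 ≤ t) :
    zetaNat t = ∑' n : ℕ, (n : ℝ) ^ (-(t : ℝ)) := by
  have ht' : (2 : ℝ) ≤ t := by exact_mod_cast ht
  have hs : Summable fun n : ℕ => (n : ℝ) ^ (-(t : ℝ)) :=
    Real.summable_nat_rpow.2 (by linarith)
  rw [hs.tsum_eq_zero_add, zetaNat]
  rw [Nat.cast_zero, Real.zero_rpow (by linarith), zero_add]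
  refine tsum_congr fun k => ?_
  rw [Real.rpow_neg (by positivity), Real.rpow_natCast, one_div]
  push_cast
  rfl

lemma geom_sum_one_div_eq {p : ℕ} (hp : p.Prime) (t : ℕ) :
    ∑ i ∈ Finset.range t, (1 : ℝ) / (p : ℝ) ^ i =
      (1 - (p : ℝ) ^ (-(t : ℝ))) * (1 - (p : ℝ)⁻¹)⁻¹ := by
  have h1 : (p : ℝ)⁻¹ < 1 := inv_lt_one_of_one_lt₀ (by exact_mod_cast hp.one_lt)
  simp_rw [one_div, ← inv_pow]
  rw [geom_sum_eq h1.ne, Real.rpow_neg p.cast_nonneg, Real.rpow_natCast, inv_pow, ← neg_sub,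
    ← neg_sub (1 : ℝ), neg_div_neg_eq, div_eq_mul_inv]

lemma Rt_primorialAt (t n : ℕ) :
    Rt t (primorialAt n) =
      (∏ p ∈ (Nat.nth Nat.Prime n).primesBelow, (1 - (p : ℝ) ^ (-(t : ℝ)))) *
        (∏ p ∈ (Nat.nth Nat.Prime n).primesBelow, (1 - (p : ℝ)⁻¹)⁻¹) /
        Real.log (∑ p ∈ (Nat.nth Nat.Prime n).primesBelow, Real.log p) := by
  rw [primorialAt_eq_prod_primesBelow]
  set s := (Nat.nth Nat.Prime n).primesBelow
  have hs : ∀ p ∈ s, p.Prime := fun p hp => Nat.prime_of_mem_primesBelow hp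
  have hne : ((∏ p ∈ s, p : ℕ) : ℝ) ≠ 0 := by
    exact_mod_cast Finset.prod_ne_zero_iff.2 fun p hp => (hs p hp).ne_zero
  have hlog : Real.log ((∏ p ∈ s, p : ℕ) : ℝ) = ∑ p ∈ s, Real.log p := by
    rw [Nat.cast_prod, Real.log_prod]
    exact fun p hp => by exact_mod_cast (hs p hp).ne_zero
  rw [Rt, Psi, Nat.primeFactors_prod hs, mul_div_mul_left _ _ hne, hlog,
    ← Finset.prod_mul_distrib]
  congr 1
  exact Finset.prod_congr rfl fun p hp => geom_sum_one_div_eq (hs p hp) t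

theorem tendsto_Rt_primorial (t : ℕ) (ht : 2 ≤ t) :
    Tendsto (fun n : ℕ => Rt t (primorialAt n)) atTop
      (nhds (Real.exp Real.eulerMascheroniConstant / zetaNat t)) := by
  have ht1 : (1 : ℝ) < t := by exact_mod_cast ht
  have hζ := (tendsto_prod_primesBelow_one_sub_rpow_inv ht1).inv₀ (tsum_rpow_neg_pos ht1).ne'
  have h := ((hζ.mul tendsto_prod_primesBelow_div_log).div
    tendsto_log_sum_log_primesBelow_div_log one_ne_zero).comp
      (Nat.nth_strictMono Nat.infinite_setOfPred_prime).tendsto_atTop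
  rw [div_one, ← zetaNat_eq_tsum_rpow_neg ht, inv_mul_eq_div] at h
  refine h.congr' ?_
  filter_upwards with n
  have hn : Real.log (Nat.nth Nat.Prime n) ≠ 0 :=
    (Real.log_pos (by exact_mod_cast (Nat.prime_nth_prime n).one_lt)).ne'
  simp only [Function.comp, Pi.div_apply, Rt_primorialAt, Finset.prod_inv_distrib, inv_inv]
  rw [← mul_div_assoc, div_div_div_cancel_right₀ hn]
end

section
/- For every n ≥ 10596 one has exp(2/p_n) · (1 + 1.1253/(log p_n · log log N_n)) < ζ(7), and consequently R_7(N_n) < e^γ, where R_7(x) := Ψ_7(x)/(x log log x). -/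
open Finset Filter

/-- The product of the primes below `347`. -/
def sieveModulus : ℕ :=
  2159704595610254721415747050533376368260798239989520222949435936418441984820398307416727184404426847652711313512004598759003964186453790

/-- A primality test, correct below `347 ^ 2`, that the kernel evaluates quickly. -/
def isPrimeFast (m : ℕ) : Bool :=
  bif Nat.blt m 361 then
    Nat.ble 2 m && [2, 3, 5, 7, 11, 13, 17].all fun d => Nat.beq m d || !Nat.beq (m % d) 0
  else Nat.beq (Nat.gcd m sieveModulus) 1

/-- The sum of `f` over `[b, b + n)`. -/
def blockSum (f : ℕ → ℕ) (b n : ℕ) : ℕ :=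
  Nat.rec 0 (fun i s => s + f (b + i)) n

/-- The sum of `f` over `[0, b * n)`, arranged in `n` blocks. -/
def gridSum (f : ℕ → ℕ) (b n : ℕ) : ℕ :=
  Nat.rec 0 (fun i s => s + blockSum f (b * i) b) n

/-- The product of `f` over `[b, b + n)`. -/
def blockProd (f : ℕ → ℕ) (b n : ℕ) : ℕ :=
  Nat.rec 1 (fun i s => s * f (b + i)) n

/-- The product of `f` over `[0, b * n)`, arranged in `n` blocks. -/
def gridProd (f : ℕ → ℕ) (b n : ℕ) : ℕ :=
  Nat.rec 1 (fun i s => s * blockProd f (b * i) b) n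

theorem blockSum_eq (f : ℕ → ℕ) (b n : ℕ) : blockSum f b n = ∑ i ∈ range n, f (b + i) := by
  induction n with
  | zero => rfl
  | succ n ih => rw [sum_range_succ, ← ih]; rfl

theorem blockProd_eq (f : ℕ → ℕ) (b n : ℕ) : blockProd f b n = ∏ i ∈ range n, f (b + i) := by
  induction n with
  | zero => rfl
  | succ n ih => rw [prod_range_succ, ← ih]; rfl

theorem gridSum_eq (f : ℕ → ℕ) (b n : ℕ) : gridSum f b n = ∑ m ∈ range (b * n), f m := by
  induction n with
  | zero => rfl
  | succ n ih => rw [mul_add_one, sum_range_add, ← ih, ← blockSum_eq]; rfl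

theorem gridProd_eq (f : ℕ → ℕ) (b n : ℕ) : gridProd f b n = ∏ m ∈ range (b * n), f m := by
  induction n with
  | zero => rfl
  | succ n ih => rw [mul_add_one, prod_range_add, ← ih, ← blockProd_eq]; rfl

theorem dvd_sieveModulus {q : ℕ} (hq : q.Prime) (h : q < 347) : q ∣ sieveModulus := by
  have key : ∀ q < 347, 2 ≤ q → sieveModulus % q = 0 ∨
      ∃ d ∈ [2, 3, 5, 7, 11, 13, 17], d < q ∧ q % d = 0 := by decide +kernel
  rcases key q h hq.two_le with h | ⟨d, hd, hdq, h⟩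
  · exact Nat.dvd_of_mod_eq_zero h
  · rcases (Nat.dvd_prime hq).1 (Nat.dvd_of_mod_eq_zero h) with rfl | rfl
    · simp at hd
    · exact absurd hdq (lt_irrefl _)

theorem lt_of_prime_dvd_sieveModulus {q : ℕ} (hq : q.Prime) (h : q ∣ sieveModulus) : q < 347 := by
  have hf : sieveModulus ∣ (346).factorial := by decide +kernel
  exact Nat.lt_succ_of_le ((Nat.Prime.dvd_factorial hq).1 (h.trans hf))

theorem isPrimeFast_eq_true_iff {m : ℕ} (hm : m < 120409) : isPrimeFast m = true ↔ m.Prime := by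
  unfold isPrimeFast
  by_cases h : m < 361
  · have hb : Nat.blt m 361 = true := by simpa [Nat.blt_eq] using h
    rw [hb, cond_true]
    constructor
    · intro ht
      simp only [Bool.and_eq_true, Nat.ble_eq, List.all_eq_true, Bool.or_eq_true, Nat.beq_eq,
        Bool.not_eq_true', ← Bool.not_eq_true] at ht
      by_contra hp
      have h1 := Nat.minFac_sq_le_self (by omega) hp
      have h2 : m.minFac < 19 := by nlinarith
      have h3 := Nat.minFac_prime (n := m) (by omega)
      have h4 := Nat.minFac_dvd m
      have h5 : m.minFac ∈ [2, 3, 5, 7, 11, 13, 17] := by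
        generalize m.minFac = q at h2 h3
        interval_cases q <;> first | decide | (exfalso; revert h3; norm_num)
      rcases ht.2 _ h5 with h6 | h6
      · exact hp (h6 ▸ h3)
      · exact h6 (Nat.mod_eq_zero_of_dvd h4)
    · intro hp
      simp only [Bool.and_eq_true, Nat.ble_eq, List.all_eq_true, Bool.or_eq_true, Nat.beq_eq,
        Bool.not_eq_true', ← Bool.not_eq_true]
      refine ⟨hp.two_le, fun d hd => ?_⟩
      by_cases hmd : m = d
      · exact Or.inl hmd
      · right
        intro h0
        rcases (Nat.dvd_prime hp).1 (Nat.dvd_of_mod_eq_zero h0) with rfl | rfl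
        · simp at hd
        · exact hmd rfl
  · have hb : Nat.blt m 361 = false := by
      rw [← Bool.not_eq_true, Nat.blt_eq]; exact h
    rw [hb, cond_false, Nat.beq_eq]
    constructor
    · intro hc
      by_contra hp
      have h1 := Nat.minFac_sq_le_self (by omega) hp
      have h2 : m.minFac < 347 := by nlinarith
      have h3 := Nat.minFac_prime (n := m) (by omega)
      exact Nat.not_coprime_of_dvd_of_dvd h3.one_lt (Nat.minFac_dvd m)
        (dvd_sieveModulus h3 h2) hc
    · intro hp
      refine (Nat.Prime.coprime_iff_not_dvd hp).2 fun hd => ?_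
      have := lt_of_prime_dvd_sieveModulus hp hd
      omega

theorem sum_primes_eq_gridSum (f : ℕ → ℕ) {b n : ℕ} (h : b * n ≤ 120409) :
    ∑ p ∈ range (b * n) with p.Prime, f p =
      gridSum (fun m => bif isPrimeFast m then f m else 0) b n := by
  rw [gridSum_eq, sum_filter]
  refine sum_congr rfl fun m hm => ?_
  have hm' := isPrimeFast_eq_true_iff ((mem_range.1 hm).trans_le h)
  by_cases hp : m.Prime
  · simp [hp, hm'.2 hp]
  · simp [hp, Bool.eq_false_iff.2 (mt hm'.1 hp)]

theorem prod_primes_eq_gridProd (f : ℕ → ℕ) {b n : ℕ} (h : b * n ≤ 120409) :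
    ∏ p ∈ range (b * n) with p.Prime, f p =
      gridProd (fun m => bif isPrimeFast m then f m else 1) b n := by
  rw [gridProd_eq, prod_filter]
  refine prod_congr rfl fun m hm => ?_
  have hm' := isPrimeFast_eq_true_iff ((mem_range.1 hm).trans_le h)
  by_cases hp : m.Prime
  · simp [hp, hm'.2 hp]
  · simp [hp, Bool.eq_false_iff.2 (mt hm'.1 hp)]

theorem mul_log_sub_self_mono {y z : ℝ} (hy : 1 ≤ y) (hyz : y ≤ z) :
    y * Real.log y - y ≤ z * Real.log z - z := by
  have hz : 0 < z := by linarith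
  have h1 : Real.log y + 1 - y / z ≤ Real.log z := by
    have h := Real.log_le_sub_one_of_pos (x := y / z) (by positivity)
    rw [Real.log_div (by positivity) (by positivity)] at h
    linarith
  have h2 := Real.log_nonneg hy
  have h3 : z * (y / z) = y := mul_div_cancel₀ y hz.ne'
  have h4 : z * (Real.log y + 1 - y / z) ≤ z * Real.log z := by gcongr
  nlinarith

theorem log_factorial_le {n : ℕ} (hn : 1 ≤ n) :
    Real.log n.factorial ≤ (n + 1) * Real.log n - n + 1 := by
  induction n, hn using Nat.le_induction with
  | base => simp
  | succ n hn ih =>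
    have hn' : (1 : ℝ) ≤ n := by exact_mod_cast hn
    rw [Nat.factorial_succ, Nat.cast_mul,
      Real.log_mul (by positivity) (by positivity)]
    have h := Real.log_le_sub_one_of_pos (x := (n : ℝ) / (n + 1)) (by positivity)
    rw [Real.log_div (by positivity) (by positivity)] at h
    have h3 : (n + 1 : ℝ) * (n / (n + 1)) = n := by field_simp
    push_cast
    nlinarith

/-- Stirling's upper bound for `log ⌊z⌋!`. -/
theorem log_factorial_floor_le {z : ℝ} (hz : 1 ≤ z) :
    Real.log (⌊z⌋₊.factorial) ≤ z * Real.log z - z + (Real.log z + 1) := by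
  have hn : 1 ≤ ⌊z⌋₊ := Nat.le_floor (by simpa using hz)
  have hn' : (1 : ℝ) ≤ ⌊z⌋₊ := by exact_mod_cast hn
  have hle : (⌊z⌋₊ : ℝ) ≤ z := Nat.floor_le (by linarith)
  have h1 := log_factorial_le hn
  have h2 := mul_log_sub_self_mono hn' hle
  have h3 : Real.log ⌊z⌋₊ ≤ Real.log z := Real.log_le_log (by linarith) hle
  linarith

/-- Stirling's lower bound for `log ⌊z⌋!`. -/
theorem le_log_factorial_floor {z : ℝ} (hz : 1 ≤ z) :
    z * Real.log z - z - (Real.log z + 1) ≤ Real.log (⌊z⌋₊.factorial) := by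
  have hn : 1 ≤ ⌊z⌋₊ := Nat.le_floor (by simpa using hz)
  have hn' : (1 : ℝ) ≤ ⌊z⌋₊ := by exact_mod_cast hn
  have hlt : z < ⌊z⌋₊ + 1 := Nat.lt_floor_add_one z
  have h1 := Stirling.le_log_factorial_stirling (n := ⌊z⌋₊) (by omega)
  have h2 := Real.log_nonneg hn'
  have h3 : 0 ≤ Real.log (2 * Real.pi) := Real.log_nonneg (by linarith [Real.pi_gt_three])
  have h4 : Real.log z - Real.log ⌊z⌋₊ ≤ z / ⌊z⌋₊ - 1 := by
    rw [← Real.log_div (by positivity) (by positivity)]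
    exact Real.log_le_sub_one_of_pos (by positivity)
  have h5 : (⌊z⌋₊ : ℝ) * (z / ⌊z⌋₊ - 1) = z - ⌊z⌋₊ := by field_simp
  have h6 := mul_le_mul_of_nonneg_left h4 (by linarith : (0 : ℝ) ≤ ⌊z⌋₊)
  have h7 := Real.log_nonneg hz
  nlinarith

/-- Legendre's formula for `log N!`, the range of summation being immaterial beyond `N`. -/
theorem log_factorial_eq_sum_vonMangoldt {N L : ℕ} (h : N ≤ L) :
    Real.log N.factorial =
      ∑ n ∈ Ioc 0 L, ArithmeticFunction.vonMangoldt n * ((N / n : ℕ) : ℝ) := by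
  have hsum : ∑ n ∈ Ioc 0 N, ArithmeticFunction.vonMangoldt n * ((N / n : ℕ) : ℝ) =
      ∑ n ∈ Ioc 0 L, ArithmeticFunction.vonMangoldt n * ((N / n : ℕ) : ℝ) := by
    refine sum_subset (Ioc_subset_Ioc_right h) fun n hn hn' => ?_
    rw [mem_Ioc] at hn hn'
    rw [Nat.div_eq_of_lt (by omega)]
    simp
  rw [← hsum, ← ArithmeticFunction.sum_Ioc_mul_zeta_eq_sum,
    ArithmeticFunction.vonMangoldt_mul_zeta, ← prod_Ico_id_eq_factorial, Nat.cast_prod,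
    Real.log_prod (fun i hi => by
      rw [mem_Ico] at hi
      exact_mod_cast (by omega : i ≠ 0))]
  refine sum_congr ?_ fun n _ => ?_
  · ext n; simp only [mem_Ico, mem_Ioc]; omega
  · simp

/-- Scales `a` and weights `e` of the terms `e * a * ⌊u / a⌋` that a Chebyshev type
approximation of `u` adds. -/
def posWeights : List (ℕ × ℕ) :=
  [(24, 1019), (25, 960), (26, 923), (27, 889), (28, 857), (29, 828), (30, 800), (31, 774),
   (32, 750), (33, 727), (34, 706), (35, 686), (36, 667), (37, 649), (38, 632), (39, 615),
   (40, 612), (41, 1137), (42, 22), (43, 710), (44, 942), (46, 522), (47, 839), (48, 169),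
   (50, 480), (52, 676), (54, 424), (56, 249), (58, 527), (60, 291), (62, 453), (64, 311),
   (66, 373), (68, 343), (70, 343), (72, 327), (78, 12), (84, 275), (90, 362), (96, 161),
   (102, 361), (108, 118), (114, 350), (132, 41), (138, 127), (144, 39), (156, 243), (168, 18),
   (192, 16), (240, 47), (252, 135), (384, 72), (432, 16), (552, 45)]

/-- Scales `a` and weights `e` of the terms `e * a * ⌊u / a⌋` that a Chebyshev type
approximation of `u` subtracts. -/
def negWeights : List (ℕ × ℕ) :=
  [(120, 153), (126, 29), (180, 114), (216, 48), (276, 63), (408, 25), (456, 8), (480, 39),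
   (504, 38), (576, 153)]

/-- The sum of `f a e` over a list of scales `a` and weights `e`. -/
def weightSum (f : ℕ → ℕ → ℕ) (l : List (ℕ × ℕ)) : ℕ :=
  List.rec 0 (fun j _ s => s + f j.1 j.2) l

/-- A step function majorizing the error of the Chebyshev type approximation. -/
def stepError (u : ℕ) : ℕ :=
  (bif Nat.ble 576 u then 74989 else 0) + (bif Nat.ble 1152 u then 115424 else 0) +
    (bif Nat.ble 4800 u then 459263 else 0)

theorem weightSum_eq (f : ℕ → ℕ → ℕ) {l : List (ℕ × ℕ)} (hl : l.Nodup) :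
    weightSum f l = ∑ j ∈ l.toFinset, f j.1 j.2 := by
  rw [List.sum_toFinset _ hl]
  induction l with
  | nil => rfl
  | cons j l ih =>
    rw [List.map_cons, List.sum_cons, ← ih (List.nodup_cons.1 hl).2, add_comm]; rfl

theorem nodup_posWeights : posWeights.Nodup := by decide +kernel

theorem nodup_negWeights : negWeights.Nodup := by decide +kernel

theorem certificate_of_lt {u : ℕ} (hu : u < 4800) :
    weightSum (fun a e => e * (u % a)) posWeights ≤
      552000 + weightSum (fun a e => e * (u % a)) negWeights + stepError u := by
  have h : gridSum (fun u => weightSum (fun a e => e * (u % a)) posWeights -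
      (552000 + weightSum (fun a e => e * (u % a)) negWeights + stepError u)) 60 80 = 0 := by
    decide +kernel
  rw [gridSum_eq, sum_eq_zero_iff] at h
  have := h u (mem_range.2 hu)
  omega

theorem certificate_nat (u : ℕ) :
    ∑ j ∈ posWeights.toFinset, j.2 * (u % j.1) ≤
      552000 + ∑ j ∈ negWeights.toFinset, j.2 * (u % j.1) + stepError u := by
  rw [← weightSum_eq (fun a e => e * (u % a)) nodup_posWeights,
    ← weightSum_eq (fun a e => e * (u % a)) nodup_negWeights]
  by_cases hu : u < 4800
  · exact certificate_of_lt hu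
  · have h : weightSum (fun a e => e * (a - 1)) posWeights = 1201676 := by decide +kernel
    have hpos : ∀ j ∈ posWeights, 0 < j.1 := by decide +kernel
    have hle : weightSum (fun a e => e * (u % a)) posWeights ≤
        weightSum (fun a e => e * (a - 1)) posWeights := by
      rw [weightSum_eq _ nodup_posWeights, weightSum_eq _ nodup_posWeights]
      refine sum_le_sum fun j hj => Nat.mul_le_mul_left _ (Nat.le_pred_of_lt (Nat.mod_lt _ ?_))
      exact hpos j (List.mem_toFinset.1 hj)
    have hs : stepError u = 649676 := by
      have h1 : Nat.ble 576 u = true := by rw [Nat.ble_eq]; omega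
      have h2 : Nat.ble 1152 u = true := by rw [Nat.ble_eq]; omega
      have h3 : Nat.ble 4800 u = true := by rw [Nat.ble_eq]; omega
      simp [stepError, h1, h2, h3]
    omega

/-- The Chebyshev type approximation of a natural number `u`. -/
theorem certificate (u : ℕ) :
    (24000 : ℝ) * (u + 1) - 576000 ≤
      ∑ j ∈ posWeights.toFinset, (j.2 * j.1 : ℝ) * (u / j.1 : ℕ) -
        ∑ j ∈ negWeights.toFinset, (j.2 * j.1 : ℝ) * (u / j.1 : ℕ) + stepError u := by
  have hp : weightSum (fun _ e => e) posWeights = 24000 + 670 := by decide +kernel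
  have hn : weightSum (fun _ e => e) negWeights = 670 := by decide +kernel
  rw [weightSum_eq _ nodup_posWeights] at hp
  rw [weightSum_eq _ nodup_negWeights] at hn
  have key (s : Finset (ℕ × ℕ)) : (∑ j ∈ s, (j.2 * j.1 : ℝ) * (u / j.1 : ℕ)) =
      (∑ j ∈ s, j.2 : ℕ) * u - (∑ j ∈ s, j.2 * (u % j.1) : ℕ) := by
    push_cast
    rw [sum_mul, ← sum_sub_distrib]
    refine sum_congr rfl fun j _ => ?_
    have : ((j.1 * (u / j.1) + u % j.1 : ℕ) : ℝ) = u := by rw [Nat.div_add_mod]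
    push_cast at this
    linear_combination (j.2 : ℝ) * this
  rw [key, key, hp, hn]
  have h : ((∑ j ∈ posWeights.toFinset, j.2 * (u % j.1) : ℕ) : ℝ) ≤
      552000 + (∑ j ∈ negWeights.toFinset, j.2 * (u % j.1) : ℕ) + stepError u := by
    exact_mod_cast certificate_nat u
  push_cast at h ⊢
  linarith

theorem le_log_of_pow_le {a k m : ℕ} (h : 2 ^ m ≤ a ^ k) :
    m * Real.log 2 ≤ k * Real.log a := by
  rw [← Real.log_pow, ← Real.log_pow]
  exact Real.log_le_log (by positivity) (by exact_mod_cast h)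

theorem log_le_of_pow_le {a k m : ℕ} (ha : a ≠ 0) (h : a ^ k ≤ 2 ^ m) :
    k * Real.log a ≤ m * Real.log 2 := by
  rw [← Real.log_pow, ← Real.log_pow]
  exact Real.log_le_log (by positivity) (by exact_mod_cast h)

theorem psi_le_mul_of_log_le {x t c : ℝ} (ht : 400 ≤ t) (hx : t ≤ x)
    (hc : Real.log t ≤ c * √t) : Chebyshev.psi x ≤ (1.3863 + 2 * c) * x := by
  have h1 := Chebyshev.psi_le (x := x) (by linarith)
  have he : Real.exp 2 ≤ 400 := by
    have : Real.exp 2 = Real.exp 1 * Real.exp 1 := by rw [← Real.exp_add]; norm_num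
    rw [this]
    nlinarith [Real.exp_one_lt_d9, Real.exp_pos 1]
  have h2 : Real.log x / √x ≤ Real.log t / √t :=
    Real.log_div_sqrt_antitoneOn (he.trans ht) ((he.trans ht).trans hx) hx
  have ht0 : 0 < √t := Real.sqrt_pos.2 (by linarith)
  have hx0 : 0 < √x := Real.sqrt_pos.2 (by linarith)
  have h3 : Real.log x ≤ c * √x := by
    rw [← div_le_iff₀ hx0]
    exact h2.trans ((div_le_iff₀ ht0).2 hc)
  have h4 : Real.log 4 ≤ 1.3863 := by
    have : Real.log 4 = 2 * Real.log 2 := by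
      rw [show (4 : ℝ) = 2 ^ 2 by norm_num, Real.log_pow]; norm_num
    linarith [Real.log_two_lt_d9]
  have h5 : √x * √x = x := Real.mul_self_sqrt (by linarith)
  have h6 : √x * Real.log x ≤ √x * (c * √x) := by gcongr
  have h7 : Real.log 4 * x ≤ 1.3863 * x := by
    gcongr
    linarith
  rw [mul_left_comm, h5] at h6
  linarith

theorem psi_div_twentyFour_le {x : ℝ} (hx : 100000 ≤ x) :
    Chebyshev.psi (x / 24) ≤ 0.0686 * x := by
  have hl : Real.log (100000 / 24) ≤ 0.12935 * √(100000 / 24) := by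
    have h1 : (64.5 : ℝ) ≤ √(100000 / 24) := Real.le_sqrt_of_sq_le (by norm_num)
    have h2 := log_le_of_pow_le (a := 4167) (k := 30) (m := 361) (by norm_num) (by decide +kernel)
    have h3 : Real.log (100000 / 24) ≤ Real.log (4167 : ℕ) :=
      Real.log_le_log (by norm_num) (by norm_num)
    push_cast at h2 h3
    linarith [Real.log_two_lt_d9]
  have := psi_le_mul_of_log_le (x := x / 24) (by norm_num) (by linarith) hl
  linarith

theorem psi_div_fortyEight_le {x : ℝ} (hx : 100000 ≤ x) :
    Chebyshev.psi (x / 48) ≤ 0.0360 * x := by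
  have hl : Real.log (100000 / 48) ≤ 0.1677 * √(100000 / 48) := by
    have h1 : (45.6 : ℝ) ≤ √(100000 / 48) := Real.le_sqrt_of_sq_le (by norm_num)
    have h2 := log_le_of_pow_le (a := 2084) (k := 100) (m := 1103) (by norm_num) (by decide +kernel)
    have h3 : Real.log (100000 / 48) ≤ Real.log (2084 : ℕ) :=
      Real.log_le_log (by norm_num) (by norm_num)
    push_cast at h2 h3
    linarith [Real.log_two_lt_d9]
  have := psi_le_mul_of_log_le (x := x / 48) (by norm_num) (by linarith) hl
  linarith

theorem psi_div_twoHundred_le {x : ℝ} (hx : 100000 ≤ x) :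
    Chebyshev.psi (x / 200) ≤ 0.00973 * x := by
  have hl : Real.log (100000 / 200) ≤ 0.2785 * √(100000 / 200) := by
    have h1 : (22.36 : ℝ) ≤ √(100000 / 200) := Real.le_sqrt_of_sq_le (by norm_num)
    have h2 := log_le_of_pow_le (a := 500) (k := 50) (m := 449) (by norm_num) (by decide +kernel)
    rw [show (100000 / 200 : ℝ) = 500 by norm_num] at h1 ⊢
    push_cast at h2
    linarith [Real.log_two_lt_d9]
  have := psi_le_mul_of_log_le (x := x / 200) (by norm_num) (by linarith) hl
  linarith

theorem le_sum_log_weights :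
    24000 * Real.log 24 + 18291 * Real.log 2 ≤
      ∑ j ∈ posWeights.toFinset, (j.2 : ℝ) * Real.log j.1 -
        ∑ j ∈ negWeights.toFinset, (j.2 : ℝ) * Real.log j.1 := by
  have hpos : ∀ j ∈ posWeights, j.1 ≠ 0 := by decide +kernel
  have hneg : ∀ j ∈ negWeights, j.1 ≠ 0 := by decide +kernel
  have key : ∀ l : List (ℕ × ℕ), l.Nodup → (∀ j ∈ l, j.1 ≠ 0) →
      ∑ j ∈ l.toFinset, (j.2 : ℝ) * Real.log j.1 =
        Real.log ((l.map fun j => j.1 ^ j.2).prod : ℕ) := by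
    intro l hl h0
    rw [← List.prod_toFinset _ hl, Nat.cast_prod, Real.log_prod]
    · refine sum_congr rfl fun j _ => ?_
      rw [Nat.cast_pow, Real.log_pow]
    · intro j hj
      exact_mod_cast pow_ne_zero _ (h0 j (List.mem_toFinset.1 hj))
  have hle : 24 ^ 24000 * 2 ^ 18291 * (negWeights.map fun j => j.1 ^ j.2).prod ≤
      (posWeights.map fun j => j.1 ^ j.2).prod := Nat.le_of_ble_eq_true (by decide +kernel)
  have hn0 : (negWeights.map fun j => j.1 ^ j.2).prod ≠ 0 := by
    rw [← List.prod_toFinset _ nodup_negWeights, prod_ne_zero_iff]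
    exact fun j hj => pow_ne_zero _ (hneg j (List.mem_toFinset.1 hj))
  rw [key _ nodup_posWeights hpos, key _ nodup_negWeights hneg]
  generalize (negWeights.map fun j => j.1 ^ j.2).prod = N at *
  generalize (posWeights.map fun j => j.1 ^ j.2).prod = P at *
  have hN : (N : ℝ) ≠ 0 := by exact_mod_cast hn0
  have h := Real.log_le_log (x := ((24 ^ 24000 * 2 ^ 18291 * N : ℕ) : ℝ))
    (by positivity) (Nat.cast_le.2 hle)
  rw [Nat.cast_mul, Nat.cast_mul, Nat.cast_pow, Nat.cast_pow, Real.log_mul (by positivity) hN,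
    Real.log_mul (by positivity) (by positivity), Real.log_pow, Real.log_pow] at h
  push_cast at h
  linarith

theorem sum_vonMangoldt_mul_step_le {x : ℝ} (hx : 0 ≤ x) {K : ℕ} (hK : 0 < K) (c : ℕ) :
    ∑ n ∈ Ioc 0 ⌊x⌋₊, ArithmeticFunction.vonMangoldt n *
        ((bif Nat.ble (24 * K) ⌊24 * x / n⌋₊ then c else 0 : ℕ) : ℝ) ≤
      c * Chebyshev.psi (x / K) := by
  have hK' : (0 : ℝ) < K := by exact_mod_cast hK
  have hsub : Ioc 0 ⌊x / K⌋₊ ⊆ Ioc 0 ⌊x⌋₊ := by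
    refine Ioc_subset_Ioc_right (Nat.floor_le_floor (div_le_self hx ?_))
    exact_mod_cast hK
  rw [Chebyshev.psi, mul_sum]
  have hz : ∀ n ∈ Ioc 0 ⌊x⌋₊, n ∉ Ioc 0 ⌊x / K⌋₊ →
      ArithmeticFunction.vonMangoldt n *
        ((bif Nat.ble (24 * K) ⌊24 * x / n⌋₊ then c else 0 : ℕ) : ℝ) = 0 := by
    intro n hn hn'
    have hn0 : 0 < n := (mem_Ioc.1 hn).1
    have hn1 : (0 : ℝ) < n := by exact_mod_cast hn0
    have hlt : x / K < n := by
      by_contra! h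
      exact hn' (mem_Ioc.2 ⟨hn0, Nat.le_floor h⟩)
    have hb : Nat.ble (24 * K) ⌊24 * x / n⌋₊ = false := by
      rw [← Bool.not_eq_true, Nat.ble_eq, not_le, Nat.floor_lt (by positivity)]
      rw [div_lt_iff₀ hK'] at hlt
      rw [div_lt_iff₀ hn1]
      push_cast
      linarith
    simp [hb]
  rw [← sum_subset hsub hz]
  refine sum_le_sum fun n _ => ?_
  have h : ((bif Nat.ble (24 * K) ⌊24 * x / n⌋₊ then c else 0 : ℕ) : ℝ) ≤ c := by
    cases Nat.ble (24 * K) ⌊24 * x / n⌋₊ <;> simp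
  rw [mul_comm (c : ℝ)]
  exact mul_le_mul_of_nonneg_left h ArithmeticFunction.vonMangoldt_nonneg

theorem le_fst_posWeights : ∀ j ∈ posWeights, 24 ≤ j.1 := by decide +kernel

theorem le_fst_negWeights : ∀ j ∈ negWeights, 24 ≤ j.1 := by decide +kernel

theorem sum_vonMangoldt_mul_weights {x : ℝ} (hx : 0 ≤ x) {l : List (ℕ × ℕ)}
    (hl : ∀ j ∈ l, 24 ≤ j.1) :
    ∑ n ∈ Ioc 0 ⌊x⌋₊, ArithmeticFunction.vonMangoldt n *
        ∑ j ∈ l.toFinset, (j.2 * j.1 : ℝ) * (⌊24 * x / n⌋₊ / j.1 : ℕ) =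
      ∑ j ∈ l.toFinset, (j.2 * j.1 : ℝ) * Real.log (⌊24 * x / j.1⌋₊.factorial) := by
  simp_rw [mul_sum]
  rw [sum_comm]
  refine sum_congr rfl fun j hj => ?_
  have hj24 : (24 : ℝ) ≤ j.1 := by exact_mod_cast hl j (List.mem_toFinset.1 hj)
  have hle : ⌊24 * x / j.1⌋₊ ≤ ⌊x⌋₊ := by
    refine Nat.floor_le_floor ?_
    rw [div_le_iff₀ (by linarith)]
    nlinarith
  rw [log_factorial_eq_sum_vonMangoldt hle, mul_sum]
  refine sum_congr rfl fun n _ => ?_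
  rw [← Nat.floor_div_natCast, ← Nat.floor_div_natCast, div_right_comm]
  ring

theorem sum_weights_mul_log_factorial {x : ℝ} {l : List (ℕ × ℕ)} (hl : ∀ j ∈ l, 24 ≤ j.1)
    (hx : ∀ j ∈ l, (j.1 : ℝ) ≤ 24 * x) :
    |∑ j ∈ l.toFinset, (j.2 * j.1 : ℝ) * Real.log (⌊24 * x / j.1⌋₊.factorial) -
        24 * x * ((∑ j ∈ l.toFinset, j.2 : ℕ) * (Real.log x + Real.log 24 - 1) -
          ∑ j ∈ l.toFinset, (j.2 : ℝ) * Real.log j.1)| ≤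
      (∑ j ∈ l.toFinset, j.2 * j.1 : ℕ) * (Real.log x + 1) := by
  push_cast
  simp_rw [sum_mul, ← sum_sub_distrib, mul_sum, ← sum_sub_distrib]
  refine (abs_sum_le_sum_abs _ _).trans (sum_le_sum fun j hj => ?_)
  rw [List.mem_toFinset] at hj
  have hj24 : (24 : ℝ) ≤ j.1 := by exact_mod_cast hl j hj
  have hj0 : (0 : ℝ) < j.1 := by linarith
  have hjx := hx j hj
  have hx0 : 0 < x := by linarith
  have hz : 1 ≤ 24 * x / j.1 := by rwa [one_le_div hj0]
  have hlog : Real.log (24 * x / j.1) = Real.log x + Real.log 24 - Real.log j.1 := by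
    rw [Real.log_div (by positivity) hj0.ne', Real.log_mul (by norm_num) hx0.ne', add_comm]
  have hlog' : Real.log (24 * x / j.1) ≤ Real.log x := by
    refine Real.log_le_log (by linarith) ?_
    rw [div_le_iff₀ hj0]
    nlinarith
  have h1 := log_factorial_floor_le hz
  have h2 := le_log_factorial_floor hz
  have he : (0 : ℝ) ≤ j.2 * j.1 := by positivity
  have hmul : (j.1 : ℝ) * (24 * x / j.1) = 24 * x := by field_simp
  have heq : (j.2 * j.1 : ℝ) * Real.log (⌊24 * x / j.1⌋₊.factorial) -
      24 * x * (j.2 * (Real.log x + Real.log 24 - 1) - j.2 * Real.log j.1) =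
      (j.2 * j.1 : ℝ) * (Real.log (⌊24 * x / j.1⌋₊.factorial) -
        (24 * x / j.1 * Real.log (24 * x / j.1) - 24 * x / j.1)) := by
    rw [hlog]
    linear_combination (j.2 * (Real.log x + Real.log 24 - 1 - Real.log j.1)) * hmul
  rw [heq, abs_mul, abs_of_nonneg he]
  refine mul_le_mul_of_nonneg_left ?_ he
  rw [abs_le]
  constructor <;> linarith

/-- A Chebyshev type upper bound for `∑_{n ≤ x} Λ(n) (1 / n - 1 / x)`. -/
theorem sum_vonMangoldt_mul_sub_le {x : ℝ} (hx : 100000 ≤ x) :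
    ∑ n ∈ Ioc 0 ⌊x⌋₊, ArithmeticFunction.vonMangoldt n * (1 / (n : ℝ) - 1 / x) ≤
      Real.log x - 1.504 := by
  have hx0 : 0 < x := by linarith
  have hpt : ∀ n ∈ Ioc 0 ⌊x⌋₊, 576000 * x *
      (ArithmeticFunction.vonMangoldt n * (1 / (n : ℝ) - 1 / x)) ≤
      ArithmeticFunction.vonMangoldt n *
          ∑ j ∈ posWeights.toFinset, (j.2 * j.1 : ℝ) * (⌊24 * x / n⌋₊ / j.1 : ℕ) -
        ArithmeticFunction.vonMangoldt n *
          ∑ j ∈ negWeights.toFinset, (j.2 * j.1 : ℝ) * (⌊24 * x / n⌋₊ / j.1 : ℕ) +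
        ArithmeticFunction.vonMangoldt n * stepError ⌊24 * x / n⌋₊ := by
    intro n hn
    have hn0 : (0 : ℝ) < n := by exact_mod_cast (mem_Ioc.1 hn).1
    have h1 := certificate ⌊24 * x / n⌋₊
    have h2 := Nat.lt_floor_add_one (24 * x / n)
    have h3 : 576000 * x * (1 / (n : ℝ) - 1 / x) = 24000 * (24 * x / n) - 576000 := by
      field_simp
      ring
    rw [mul_left_comm, h3, ← mul_sub, ← mul_add]
    refine mul_le_mul_of_nonneg_left ?_ ArithmeticFunction.vonMangoldt_nonneg
    linarith
  have hsum := sum_le_sum hpt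
  rw [← mul_sum, sum_add_distrib, sum_sub_distrib,
    sum_vonMangoldt_mul_weights hx0.le le_fst_posWeights,
    sum_vonMangoldt_mul_weights hx0.le le_fst_negWeights] at hsum
  have hstep : ∑ n ∈ Ioc 0 ⌊x⌋₊, ArithmeticFunction.vonMangoldt n * stepError ⌊24 * x / n⌋₊ ≤
      13770 * x := by
    have h1 := sum_vonMangoldt_mul_step_le hx0.le (K := 24) (by norm_num) 74989
    have h2 := sum_vonMangoldt_mul_step_le hx0.le (K := 48) (by norm_num) 115424
    have h3 := sum_vonMangoldt_mul_step_le hx0.le (K := 200) (by norm_num) 459263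
    have h4 := psi_div_twentyFour_le hx
    have h5 := psi_div_fortyEight_le hx
    have h6 := psi_div_twoHundred_le hx
    simp only [stepError, Nat.cast_add, mul_add, sum_add_distrib]
    norm_num at h1 h2 h3
    linarith
  have hpos := (abs_le.1 (sum_weights_mul_log_factorial (x := x) le_fst_posWeights fun j hj => by
    have h : ∀ j ∈ posWeights, j.1 ≤ 2400000 := by decide +kernel
    have h' : (j.1 : ℝ) ≤ 2400000 := by exact_mod_cast h j hj
    linarith)).2
  have hneg := (abs_le.1 (sum_weights_mul_log_factorial (x := x) le_fst_negWeights fun j hj => by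
    have h : ∀ j ∈ negWeights, j.1 ≤ 2400000 := by decide +kernel
    have h' : (j.1 : ℝ) ≤ 2400000 := by exact_mod_cast h j hj
    linarith)).1
  have hp : weightSum (fun _ e => e) posWeights = 24670 := by decide +kernel
  have hn : weightSum (fun _ e => e) negWeights = 670 := by decide +kernel
  have hp' : weightSum (fun a e => e * a) posWeights +
    weightSum (fun a e => e * a) negWeights = 1436484 := by decide +kernel
  rw [weightSum_eq _ nodup_posWeights] at hp
  rw [weightSum_eq _ nodup_negWeights] at hn
  rw [weightSum_eq _ nodup_posWeights, weightSum_eq _ nodup_negWeights] at hp'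
  have hp'' : ((∑ j ∈ posWeights.toFinset, j.2 * j.1 : ℕ) : ℝ) +
    (∑ j ∈ negWeights.toFinset, j.2 * j.1 : ℕ) = 1436484 := by exact_mod_cast hp'
  rw [hp] at hpos
  rw [hn] at hneg
  have herr : 1436484 * (Real.log x + 1) ≤ 181 * x := by
    have h1 := log_le_of_pow_le (a := 100000) (k := 31) (m := 515) (by norm_num) (by decide +kernel)
    have h2 : Real.log x / x ≤ Real.log 100000 / 100000 := by
      have he : Real.exp 1 ≤ 100000 := by linarith [Real.exp_one_lt_d9]
      exact Real.log_div_self_antitoneOn he (he.trans hx) hx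
    rw [div_le_iff₀ hx0] at h2
    push_cast at h1
    have h3 : Real.log 100000 ≤ 11.52 := by linarith [Real.log_two_lt_d9]
    have h4 : Real.log 100000 / 100000 * x ≤ 11.52 / 100000 * x := by gcongr
    linarith
  have hw := mul_le_mul_of_nonneg_left le_sum_log_weights (by linarith : 0 ≤ 24 * x)
  have hl2 := mul_le_mul_of_nonneg_left Real.log_two_gt_d9.le (by linarith : 0 ≤ 24 * 18291 * x)
  generalize ∑ j ∈ posWeights.toFinset, (j.2 * j.1 : ℝ) *
    Real.log (⌊24 * x / j.1⌋₊.factorial) = A1 at *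
  generalize ∑ j ∈ negWeights.toFinset, (j.2 * j.1 : ℝ) *
    Real.log (⌊24 * x / j.1⌋₊.factorial) = A2 at *
  generalize ∑ j ∈ posWeights.toFinset, (j.2 : ℝ) * Real.log j.1 = A3 at *
  generalize ∑ j ∈ negWeights.toFinset, (j.2 : ℝ) * Real.log j.1 = A4 at *
  push_cast at hpos hneg hp''
  generalize ∑ j ∈ posWeights.toFinset, (j.2 : ℝ) * j.1 = A5 at *
  generalize ∑ j ∈ negWeights.toFinset, (j.2 : ℝ) * j.1 = A6 at *
  have hA : A5 = 1436484 - A6 := by linarith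
  subst hA
  refine le_of_mul_le_mul_left (hsum.trans ?_) (by linarith : 0 < 576000 * x)
  nlinarith

/-- The function `1 / log t + 1 / (log t) ^ 2`. -/
noncomputable def invLogAddSq (t : ℝ) : ℝ := 1 / Real.log t + 1 / Real.log t ^ 2

/-- The negated derivative of `invLogAddSq`. -/
noncomputable def invLogAddSqDeriv (t : ℝ) : ℝ :=
  1 / (t * Real.log t ^ 2) + 2 / (t * Real.log t ^ 3)

theorem invLogAddSqDeriv_nonneg {t : ℝ} (ht : 1 < t) : 0 ≤ invLogAddSqDeriv t := by
  have := Real.log_pos ht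
  unfold invLogAddSqDeriv
  positivity

theorem continuousOn_invLogAddSqDeriv {a b : ℝ} (ha : 1 < a) (hab : a ≤ b) :
    ContinuousOn invLogAddSqDeriv (Set.uIcc a b) := by
  rw [Set.uIcc_of_le hab]
  unfold invLogAddSqDeriv
  have hne : ∀ t ∈ Set.Icc a b, t ≠ 0 := fun t ht => by linarith [ht.1]
  have hl : ∀ t ∈ Set.Icc a b, 0 < Real.log t := fun t ht => Real.log_pos (by linarith [ht.1])
  have hc : ContinuousOn Real.log (Set.Icc a b) :=
    Real.continuousOn_log.mono fun t ht => hne t ht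
  refine ContinuousOn.add (ContinuousOn.div (by fun_prop) (by fun_prop) fun t ht => ?_)
    (ContinuousOn.div (by fun_prop) (by fun_prop) fun t ht => ?_)
  · exact mul_ne_zero (hne t ht) (pow_ne_zero _ (hl t ht).ne')
  · exact mul_ne_zero (hne t ht) (pow_ne_zero _ (hl t ht).ne')

theorem hasDerivAt_invLogAddSq {t : ℝ} (ht : 1 < t) :
    HasDerivAt invLogAddSq (-invLogAddSqDeriv t) t := by
  have hl := Real.log_pos ht
  have h := Real.hasDerivAt_log (x := t) (by linarith)
  have h1 := (h.inv hl.ne').add ((h.pow 2).inv (pow_ne_zero 2 hl.ne'))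
  have h2 : invLogAddSq = Real.log⁻¹ + (Real.log ^ 2)⁻¹ := by
    ext s; simp [invLogAddSq]
  rw [h2]
  convert! h1 using 1
  unfold invLogAddSqDeriv
  simp
  field_simp
  ring

theorem hasDerivAt_inv_mul_log {t : ℝ} (ht : 1 < t) :
    HasDerivAt (fun t => 1 / (t * Real.log t)) (-invLogAddSq t / t ^ 2) t := by
  have hl := Real.log_pos ht
  have h := (hasDerivAt_id t).mul (Real.hasDerivAt_log (x := t) (by linarith))
  have h1 := h.inv (mul_ne_zero (by simp; linarith) hl.ne')
  convert! h1 using 1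
  · ext s; simp
  · unfold invLogAddSq
    have : t ≠ 0 := by linarith
    simp
    field_simp

theorem inv_mul_log_sub_eq_integral {a b : ℝ} (ha : 1 < a) (hab : a ≤ b) :
    1 / (a * Real.log a) - 1 / (b * Real.log b) =
      invLogAddSq b * (1 / a - 1 / b) + ∫ t in a..b, invLogAddSqDeriv t * (1 / a - 1 / t) := by
  have hne : ∀ t ∈ Set.uIcc a b, t ≠ 0 := fun t ht => by
    rw [Set.uIcc_of_le hab] at ht
    linarith [ht.1]
  have hd : ∀ t ∈ Set.uIcc a b,
      HasDerivAt (fun t => -invLogAddSq t * (1 / a - 1 / t) - 1 / (t * Real.log t))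
        (invLogAddSqDeriv t * (1 / a - 1 / t)) t := by
    intro t ht
    have ht1 : 1 < t := by
      rw [Set.uIcc_of_le hab] at ht
      linarith [ht.1]
    have h1 := ((hasDerivAt_invLogAddSq ht1).neg.mul
      ((hasDerivAt_const t (1 / a)).sub (hasDerivAt_inv (x := t) (by linarith)))).sub
      (hasDerivAt_inv_mul_log ht1)
    convert! h1 using 1
    · ext s; simp
    · simp only [Pi.neg_apply, Pi.sub_apply]
      ring
  rw [intervalIntegral.integral_eq_sub_of_hasDerivAt hd]
  · ring
  · refine ContinuousOn.intervalIntegrable ?_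
    refine (continuousOn_invLogAddSqDeriv ha hab).mul (continuousOn_const.sub ?_)
    exact continuousOn_const.div continuousOn_id hne

theorem continuousOn_invLogAddSqDeriv_mul_max {a b c : ℝ} (ha : 1 < a) (hab : a ≤ b) :
    ContinuousOn (fun t => invLogAddSqDeriv t * max (1 / c - 1 / t) 0) (Set.uIcc a b) := by
  refine (continuousOn_invLogAddSqDeriv ha hab).mul (ContinuousOn.sup
    (continuousOn_const.sub (continuousOn_const.div continuousOn_id fun t ht => ?_))
    continuousOn_const)
  rw [Set.uIcc_of_le hab] at ht
  linarith [ht.1]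

theorem inv_mul_log_sub_le {a b c : ℝ} (ha : 1 < a) (hab : a ≤ b) (hac : a ≤ c) :
    1 / (c * Real.log c) - 1 / (b * Real.log b) ≤
      invLogAddSq b * max (1 / c - 1 / b) 0 +
        ∫ t in a..b, invLogAddSqDeriv t * max (1 / c - 1 / t) 0 := by
  have hc : 1 < c := by linarith
  have hb : 1 < b := by linarith
  have hnn : ∀ t ∈ Set.Icc a b, 0 ≤ invLogAddSqDeriv t * max (1 / c - 1 / t) 0 := fun t ht =>
    mul_nonneg (invLogAddSqDeriv_nonneg (by linarith [ht.1])) (le_max_right _ _)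
  have hlb := Real.log_pos hb
  have hlc := Real.log_pos hc
  have hh : 0 ≤ invLogAddSq b := by unfold invLogAddSq; positivity
  rcases le_total c b with hcb | hbc
  · rw [inv_mul_log_sub_eq_integral hc hcb]
    have hint (u : ℝ) (hu : a ≤ u) (hub : u ≤ b) : IntervalIntegrable
        (fun t => invLogAddSqDeriv t * max (1 / c - 1 / t) 0) MeasureTheory.volume u b :=
      (continuousOn_invLogAddSqDeriv_mul_max (by linarith) hub).intervalIntegrable
    have hint' : IntervalIntegrable
        (fun t => invLogAddSqDeriv t * max (1 / c - 1 / t) 0) MeasureTheory.volume a c :=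
      (continuousOn_invLogAddSqDeriv_mul_max ha hac).intervalIntegrable
    refine add_le_add (mul_le_mul_of_nonneg_left (le_max_left _ _) hh) ?_
    rw [← intervalIntegral.integral_add_adjacent_intervals hint' (hint c hac hcb)]
    have h1 : 0 ≤ ∫ t in a..c, invLogAddSqDeriv t * max (1 / c - 1 / t) 0 :=
      intervalIntegral.integral_nonneg hac fun t ht => hnn t ⟨ht.1, ht.2.trans hcb⟩
    have h2 : ∫ t in c..b, invLogAddSqDeriv t * (1 / c - 1 / t) =
        ∫ t in c..b, invLogAddSqDeriv t * max (1 / c - 1 / t) 0 := by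
      refine intervalIntegral.integral_congr fun t ht => ?_
      rw [Set.uIcc_of_le hcb] at ht
      have : 1 / t ≤ 1 / c := one_div_le_one_div_of_le (by linarith) ht.1
      rw [max_eq_left (by linarith)]
    linarith
  · have h1 : 1 / (c * Real.log c) ≤ 1 / (b * Real.log b) := by gcongr
    have h2 : 0 ≤ ∫ t in a..b, invLogAddSqDeriv t * max (1 / c - 1 / t) 0 :=
      intervalIntegral.integral_nonneg hab hnn
    have h3 := mul_nonneg hh (le_max_right (1 / c - 1 / b) 0)
    linarith

/-- Integration by parts against `invLogAddSqDeriv` of `log t + u + v / t`. -/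
theorem integral_invLogAddSqDeriv_mul {a b : ℝ} (ha : 1 < a) (hab : a ≤ b) (u v : ℝ) :
    invLogAddSq b * (Real.log b + u + v / b) +
        ∫ t in a..b, invLogAddSqDeriv t * (Real.log t + u + v / t) =
      invLogAddSq a * (Real.log a + u + v / a) +
        (Real.log (Real.log b) - 1 / Real.log b + v * (1 / (b * Real.log b))) -
        (Real.log (Real.log a) - 1 / Real.log a + v * (1 / (a * Real.log a))) := by
  have hgt : ∀ t ∈ Set.uIcc a b, 1 < t := fun t ht => by
    rw [Set.uIcc_of_le hab] at ht
    linarith [ht.1]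
  have hd : ∀ t ∈ Set.uIcc a b,
      HasDerivAt (fun t => -invLogAddSq t * (Real.log t + u + v / t) +
        (Real.log (Real.log t) - 1 / Real.log t + v * (1 / (t * Real.log t))))
        (invLogAddSqDeriv t * (Real.log t + u + v / t)) t := by
    intro t ht
    have ht1 := hgt t ht
    have hl := Real.log_pos ht1
    have ht0 : t ≠ 0 := by linarith
    have hlog := Real.hasDerivAt_log ht0
    have h1 := ((hasDerivAt_invLogAddSq ht1).neg.mul
      ((hlog.add_const u).add ((hasDerivAt_inv ht0).const_mul v))).add
      (((hlog.log hl.ne').sub (hlog.inv hl.ne')).add ((hasDerivAt_inv_mul_log ht1).const_mul v))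
    convert! h1 using 1
    · ext s; simp [div_eq_mul_inv]
    · simp [invLogAddSq]
      field_simp
      ring
  rw [intervalIntegral.integral_eq_sub_of_hasDerivAt hd]
  · ring
  · refine ContinuousOn.intervalIntegrable ?_
    refine (continuousOn_invLogAddSqDeriv ha hab).mul (ContinuousOn.add
      (ContinuousOn.add (Real.continuousOn_log.mono fun t ht => ?_) continuousOn_const)
      (continuousOn_const.div continuousOn_id fun t ht => ?_)) <;>
    · have := hgt t ht
      simp
      linarith

/-- The sum `∑_{n ≤ x} Λ(n) (1 / n - 1 / x)` at `x = 100000`. -/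
noncomputable def vonMangoldtBase : ℝ :=
  ∑ n ∈ Ioc 0 100000, ArithmeticFunction.vonMangoldt n * (1 / (n : ℝ) - 1 / 100000)

theorem sum_log_mul_max_le (N : ℕ) {t : ℝ} (ht : 100000 ≤ t) :
    ∑ p ∈ Ioc 100000 N with p.Prime, Real.log p * max (1 / (p : ℝ) - 1 / t) 0 ≤
      Real.log t + (-1.504 - vonMangoldtBase - Chebyshev.theta 100000 / 100000) +
        Chebyshev.theta 100000 / t := by
  have ht0 : 0 < t := by linarith
  have hft : 100000 ≤ ⌊t⌋₊ := Nat.le_floor (by exact_mod_cast ht)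
  have hle : ∑ p ∈ Ioc 100000 N with p.Prime, Real.log p * max (1 / (p : ℝ) - 1 / t) 0 ≤
      ∑ n ∈ Ioc 100000 ⌊t⌋₊, ArithmeticFunction.vonMangoldt n * (1 / (n : ℝ) - 1 / t) := by
    have hnn : ∀ n ∈ Ioc 100000 ⌊t⌋₊,
        0 ≤ ArithmeticFunction.vonMangoldt n * (1 / (n : ℝ) - 1 / t) := by
      intro n hn
      rw [mem_Ioc] at hn
      refine mul_nonneg ArithmeticFunction.vonMangoldt_nonneg (sub_nonneg.2 ?_)
      exact one_div_le_one_div_of_le (by exact_mod_cast (by omega : 0 < n))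
        ((Nat.le_floor_iff ht0.le).1 hn.2)
    calc _ ≤ ∑ p ∈ Ioc 100000 N with p.Prime ∧ p ≤ ⌊t⌋₊,
          ArithmeticFunction.vonMangoldt p * (1 / (p : ℝ) - 1 / t) := by
          rw [← filter_filter, sum_filter (fun p => p ≤ ⌊t⌋₊)]
          refine sum_le_sum fun p hp => ?_
          rw [mem_filter, mem_Ioc] at hp
          have hp0 : (0 : ℝ) < p := by exact_mod_cast hp.2.pos
          split_ifs with h
          · have h' : (p : ℝ) ≤ t := (Nat.le_floor_iff ht0.le).1 h
            rw [ArithmeticFunction.vonMangoldt_apply_prime hp.2, max_eq_left]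
            exact sub_nonneg.2 (one_div_le_one_div_of_le hp0 h')
          · have h' : t < p := (Nat.floor_lt ht0.le).1 (not_le.1 h)
            rw [max_eq_right, mul_zero]
            exact sub_nonpos.2 (one_div_le_one_div_of_le ht0 h'.le)
      _ ≤ _ := by
          refine sum_le_sum_of_subset_of_nonneg (fun p hp => ?_) fun n hn _ => hnn n hn
          rw [mem_filter, mem_Ioc] at hp
          exact mem_Ioc.2 ⟨hp.1.1, hp.2.2⟩
  have hsplit : ∑ n ∈ Ioc 0 100000, ArithmeticFunction.vonMangoldt n * (1 / (n : ℝ) - 1 / t) =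
      vonMangoldtBase + Chebyshev.psi 100000 * (1 / 100000 - 1 / t) := by
    have hf : ⌊(100000 : ℝ)⌋₊ = 100000 := Nat.floor_ofNat 100000
    rw [vonMangoldtBase, Chebyshev.psi, hf, sum_mul, ← sum_add_distrib]
    exact sum_congr rfl fun n _ => by ring
  have hpsi : Chebyshev.theta 100000 * (1 / 100000 - 1 / t) ≤
      Chebyshev.psi 100000 * (1 / 100000 - 1 / t) :=
    mul_le_mul_of_nonneg_right (Chebyshev.theta_le_psi _)
      (sub_nonneg.2 (one_div_le_one_div_of_le (by norm_num) ht))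
  have hmain := sum_vonMangoldt_mul_sub_le ht
  rw [← sum_Ioc_consecutive _ (Nat.zero_le 100000) hft, hsplit] at hmain
  have : Chebyshev.theta 100000 * (1 / 100000 - 1 / t) =
    Chebyshev.theta 100000 / 100000 - Chebyshev.theta 100000 / t := by ring
  linarith

/-- An upper bound for the sum of the reciprocals of the primes in `(100000, N]` in terms of
`log log θ(N)`. -/
theorem sum_inv_prime_le {N : ℕ} (hN : 100000 ≤ N) (hw : 100000 ≤ Chebyshev.theta N) :
    ∑ p ∈ Ioc 100000 N with p.Prime, 1 / (p : ℝ) ≤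
      Real.log (Real.log (Chebyshev.theta N)) - Real.log (Real.log 100000) +
        invLogAddSq 100000 * (Real.log 100000 - 1.504 - vonMangoldtBase) +
        (1 - Chebyshev.theta 100000 / 100000) / Real.log 100000 := by
  set w := Chebyshev.theta N with hwdef
  set v := Chebyshev.theta 100000 with hv
  set u := -1.504 - vonMangoldtBase - v / 100000 with hu
  set P := (Ioc 100000 N).filter Nat.Prime with hP
  have hw1 : (1 : ℝ) < w := by linarith
  have hmem : ∀ p ∈ P, 100000 ≤ (p : ℝ) ∧ p.Prime := fun p hp => by
    rw [hP, mem_filter, mem_Ioc] at hp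
    exact ⟨by exact_mod_cast hp.1.1.le, hp.2⟩
  have hlog : ∀ p ∈ P, 0 < Real.log p := fun p hp => Real.log_pos (by linarith [(hmem p hp).1])
  have hlw := Real.log_pos hw1
  have hsumlog : ∑ p ∈ P, Real.log p = w - v := by
    have hf : ⌊(100000 : ℝ)⌋₊ = 100000 := Nat.floor_ofNat 100000
    rw [hwdef, hv, Chebyshev.theta, Chebyshev.theta, Nat.floor_natCast, hf, hP, sum_filter,
      sum_filter, sum_filter, ← sum_Ioc_consecutive _ (Nat.zero_le 100000) hN]
    ring
  have hpt : ∀ p ∈ P, 1 / (p : ℝ) ≤ Real.log p * (1 / (w * Real.log w)) +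
      (invLogAddSq w * (Real.log p * max (1 / (p : ℝ) - 1 / w) 0) +
        ∫ t in (100000 : ℝ)..w,
          invLogAddSqDeriv t * (Real.log p * max (1 / (p : ℝ) - 1 / t) 0)) := by
    intro p hp
    have h1 := inv_mul_log_sub_le (a := 100000) (by norm_num) hw (hmem p hp).1
    have h2 := mul_le_mul_of_nonneg_left h1 (hlog p hp).le
    have h3 : Real.log p * (1 / (p * Real.log p)) = 1 / p := by
      have := (hlog p hp).ne'
      have h0 : (p : ℝ) ≠ 0 := by linarith [(hmem p hp).1]
      field_simp
    have h4 : ∫ t in (100000 : ℝ)..w,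
        invLogAddSqDeriv t * (Real.log p * max (1 / (p : ℝ) - 1 / t) 0) =
        Real.log p * ∫ t in (100000 : ℝ)..w, invLogAddSqDeriv t * max (1 / (p : ℝ) - 1 / t) 0 := by
      rw [← intervalIntegral.integral_const_mul]
      exact intervalIntegral.integral_congr fun t _ => mul_left_comm _ _ _
    rw [h4]
    linarith
  have hsum := sum_le_sum hpt
  have hcont : ∀ p ∈ P, ContinuousOn
      (fun t => invLogAddSqDeriv t * (Real.log p * max (1 / (p : ℝ) - 1 / t) 0))
      (Set.uIcc 100000 w) := fun p _ => by
    refine ((continuousOn_invLogAddSqDeriv_mul_max (c := p) (by norm_num) hw).const_mul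
      (Real.log p)).congr fun t _ => mul_left_comm _ _ _
  rw [sum_add_distrib, sum_add_distrib, ← sum_mul, hsumlog, ← mul_sum,
    ← intervalIntegral.integral_finsetSum fun p hp => (hcont p hp).intervalIntegrable] at hsum
  have hh : 0 ≤ invLogAddSq w := by unfold invLogAddSq; positivity
  have hk : invLogAddSq w * ∑ p ∈ P, Real.log p * max (1 / (p : ℝ) - 1 / w) 0 ≤
      invLogAddSq w * (Real.log w + u + v / w) :=
    mul_le_mul_of_nonneg_left (sum_log_mul_max_le N hw) hh
  have hne : ∀ t ∈ Set.uIcc 100000 w, t ≠ 0 := fun t ht => by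
    rw [Set.uIcc_of_le hw] at ht
    linarith [ht.1]
  have hI : ∫ t in (100000 : ℝ)..w,
        ∑ p ∈ P, invLogAddSqDeriv t * (Real.log p * max (1 / (p : ℝ) - 1 / t) 0) ≤
      ∫ t in (100000 : ℝ)..w, invLogAddSqDeriv t * (Real.log t + u + v / t) := by
    refine intervalIntegral.integral_mono_on hw
      (continuousOn_finsetSum P hcont).intervalIntegrable ?_ fun t ht => ?_
    · refine ContinuousOn.intervalIntegrable ?_
      refine (continuousOn_invLogAddSqDeriv (by norm_num) hw).mul (ContinuousOn.add
        (ContinuousOn.add (Real.continuousOn_log.mono fun t ht => hne t ht) continuousOn_const)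
        (continuousOn_const.div continuousOn_id hne))
    · rw [← mul_sum]
      exact mul_le_mul_of_nonneg_left (sum_log_mul_max_le N ht.1)
        (invLogAddSqDeriv_nonneg (by linarith [ht.1]))
  have hparts := integral_invLogAddSqDeriv_mul (a := 100000) (by norm_num) hw u v
  have hx : (w - v) * (1 / (w * Real.log w)) =
      1 / Real.log w - v * (1 / (w * Real.log w)) := by
    have : w ≠ 0 := by linarith
    field_simp
  have hy : (1 - v / 100000) / Real.log 100000 =
      1 / Real.log 100000 - v * (1 / (100000 * Real.log 100000)) := by
    have : Real.log 100000 ≠ 0 := (Real.log_pos (by norm_num)).ne'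
    field_simp
  have hz : Real.log 100000 + u + v / 100000 = Real.log 100000 - 1.504 - vonMangoldtBase := by
    rw [hu]; ring
  rw [hz] at hparts
  rw [hx] at hsum
  rw [hy]
  linarith

theorem le_of_ble {a b : ℕ} (h : Nat.ble a b = true) : a ≤ b := Nat.le_of_ble_eq_true h

/-- The floor of the binary logarithm of `y`, for `0 < y < 2 ^ 2 ^ j`. -/
def log2Below (j : ℕ) : ℕ → ℕ :=
  Nat.rec (fun _ => 0) (fun j ih y =>
    bif Nat.ble (Nat.pow 2 (Nat.pow 2 j)) y then
      Nat.pow 2 j + ih (y / Nat.pow 2 (Nat.pow 2 j))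
    else ih y) j

theorem two_pow_log2Below_le (j : ℕ) {y : ℕ} (hy : 1 ≤ y) : 2 ^ log2Below j y ≤ y := by
  induction j generalizing y with
  | zero => exact hy
  | succ j ih =>
    change 2 ^ (bif Nat.ble (2 ^ 2 ^ j) y then 2 ^ j + log2Below j (y / 2 ^ 2 ^ j)
      else log2Below j y) ≤ y
    cases h : Nat.ble (2 ^ 2 ^ j) y with
    | false => exact ih hy
    | true =>
      have h1 : 1 ≤ y / 2 ^ 2 ^ j := Nat.div_pos (Nat.le_of_ble_eq_true h) (by positivity)
      rw [cond_true, pow_add, mul_comm]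
      exact (Nat.mul_le_mul_right _ (ih h1)).trans (Nat.div_mul_le_self _ _)

theorem log2Below_mul_log_two_le (j k : ℕ) {a : ℕ} (ha : 1 ≤ a) :
    log2Below j (Nat.pow a k) * Real.log 2 ≤ k * Real.log a :=
  le_log_of_pow_le (two_pow_log2Below_le j (Nat.one_le_pow k a ha))

set_option maxRecDepth 100000 in
theorem le_gridSum_log2Below : 146772976839011 ≤ gridSum (fun m => bif isPrimeFast m then
    log2Below 15 (Nat.pow m 1024) *
      blockSum (fun k => 10000000000 / Nat.pow m k - 100000) 1 16 else 0) 250 400 :=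
  le_of_ble (by decide +kernel)

set_option maxRecDepth 100000 in
theorem gridSum_isPrimeFast :
    gridSum (fun m => bif isPrimeFast m then 1 else 0) 250 447 = 10595 :=
  Nat.eq_of_beq_eq_true (by decide +kernel)

theorem card_primes_lt_111750 : #{p ∈ range (250 * 447) | p.Prime} = 10595 := by
  rw [card_eq_sum_ones, sum_primes_eq_gridSum (fun _ => 1) (by norm_num)]
  exact gridSum_isPrimeFast

set_option maxRecDepth 100000 in
theorem two_pow_le_gridProd_400 :
    2 ^ 143815 ≤ gridProd (fun m => bif isPrimeFast m then m else 1) 250 400 :=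
  le_of_ble (by decide +kernel)

set_option maxRecDepth 100000 in
theorem two_pow_le_gridProd_447 :
    2 ^ 160556 ≤ gridProd (fun m => bif isPrimeFast m then m else 1) 250 447 :=
  le_of_ble (by decide +kernel)

set_option maxRecDepth 100000 in
theorem gridProd_le_gridProd_sub_one :
    10000000 * gridProd (fun m => bif isPrimeFast m then m else 1) 250 400 ≤
      205115929 * gridProd (fun m => bif isPrimeFast m then m - 1 else 1) 250 400 :=
  le_of_ble (by decide +kernel)

theorem two_pow_le_prod_primes_lt_100000 :
    2 ^ 143815 ≤ ∏ p ∈ range (250 * 400) with p.Prime, p := by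
  rw [prod_primes_eq_gridProd (fun p => p) (by norm_num)]
  exact two_pow_le_gridProd_400

theorem two_pow_le_prod_primes_lt_111750 :
    2 ^ 160556 ≤ ∏ p ∈ range (250 * 447) with p.Prime, p := by
  rw [prod_primes_eq_gridProd (fun p => p) (by norm_num)]
  exact two_pow_le_gridProd_447

theorem prod_primes_le_mul_prod_sub_one :
    10000000 * ∏ p ∈ range (250 * 400) with p.Prime, p ≤
      205115929 * ∏ p ∈ range (250 * 400) with p.Prime, (p - 1) := by
  rw [prod_primes_eq_gridProd (fun p => p) (by norm_num),
    prod_primes_eq_gridProd (fun p => p - 1) (by norm_num)]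
  exact gridProd_le_gridProd_sub_one

set_option maxRecDepth 100000 in
theorem le_gridSum_div : 8894859754428 ≤ gridSum (fun i => 1000000000000 / i) 64 64 :=
  le_of_ble (by decide +kernel)

theorem log_100000_mem : 11.5129 ≤ Real.log 100000 ∧ Real.log 100000 ≤ 11.513 := by
  have h1 := le_log_of_pow_le (a := 100000) (k := 65536) (m := 1088529)
    (le_of_ble (by decide +kernel))
  have h2 := log_le_of_pow_le (a := 100000) (k := 65536) (m := 1088530) (by norm_num)
    (le_of_ble (by decide +kernel))
  have := Real.log_two_gt_d9
  have := Real.log_two_lt_d9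
  push_cast at h1 h2
  constructor <;> linarith

theorem le_log_111750 : 1099033 * Real.log 2 ≤ 65536 * Real.log 111750 := by
  exact_mod_cast le_log_of_pow_le (a := 111750) (k := 65536) (m := 1099033)
    (le_of_ble (by decide +kernel))

theorem le_log_111300 : 1098651 * Real.log 2 ≤ 65536 * Real.log 111300 := by
  exact_mod_cast le_log_of_pow_le (a := 111300) (k := 65536) (m := 1098651)
    (le_of_ble (by decide +kernel))

theorem primes_le_nth_eq_image (n : ℕ) :
    {q ∈ range (Nat.nth Nat.Prime n + 1) | q.Prime} =
      (range (n + 1)).image (Nat.nth Nat.Prime) := by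
  ext q
  rw [mem_filter, mem_image, mem_range, Nat.lt_succ_iff]
  constructor
  · rintro ⟨hq, hp⟩
    refine ⟨Nat.count Nat.Prime q, ?_, Nat.nth_count hp⟩
    rw [mem_range, Nat.lt_succ_iff]
    exact (Nat.count_le_iff_le_nth Nat.infinite_setOfPred_prime).2 hq
  · rintro ⟨k, hk, rfl⟩
    rw [mem_range, Nat.lt_succ_iff] at hk
    exact ⟨Nat.nth_monotone Nat.infinite_setOfPred_prime hk, Nat.prime_nth_prime k⟩

theorem primorialAt_eq {n : ℕ} (hn : 1 ≤ n) : primorialAt n = primorial (nthPrime n) := by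
  obtain ⟨m, rfl⟩ := Nat.exists_eq_add_of_le' hn
  rw [primorial, nthPrime, Nat.add_sub_cancel, primes_le_nth_eq_image, primorialAt,
    prod_image (Nat.nth_injective Nat.infinite_setOfPred_prime).injOn]

theorem prime_nthPrime (n : ℕ) : (nthPrime n).Prime := Nat.prime_nth_prime _

theorem log_primorialAt {n : ℕ} (hn : 1 ≤ n) :
    Real.log (primorialAt n) = Chebyshev.theta (nthPrime n) := by
  rw [primorialAt_eq hn, Chebyshev.theta_eq_log_primorial, Nat.floor_natCast]

theorem le_nthPrime {n : ℕ} (hn : 10596 ≤ n) : 111750 ≤ nthPrime n := by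
  rw [nthPrime, ← Nat.count_le_iff_le_nth Nat.infinite_setOfPred_prime,
    Nat.count_eq_card_filter_range]
  have := card_primes_lt_111750
  norm_num only at this
  omega

theorem mul_log_two_add_log_le_theta {m a N : ℕ} (ha : 1 ≤ a) (h : 2 ^ m * a ≤ primorial N) :
    m * Real.log 2 + Real.log a ≤ Chebyshev.theta N := by
  have ha' : (0 : ℝ) < a := by exact_mod_cast ha
  rw [Chebyshev.theta_eq_log_primorial, Nat.floor_natCast, ← Real.log_pow,
    ← Real.log_mul (by positivity) ha'.ne']
  exact Real.log_le_log (by positivity) (by exact_mod_cast h)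

theorem le_theta_prime {p : ℕ} (hp : p.Prime) (h : 111750 ≤ p) :
    160556 * Real.log 2 + Real.log 111750 ≤ Chebyshev.theta p := by
  refine mul_log_two_add_log_le_theta (m := 160556) (a := 111750) (by norm_num) ?_
  rw [primorial, range_add_one, filter_insert, if_pos hp, prod_insert (by simp), mul_comm]
  refine Nat.mul_le_mul h (two_pow_le_prod_primes_lt_111750.trans ?_)
  refine prod_le_prod_of_subset_of_one_le' (filter_subset_filter _ (range_subset_range.2 ?_)) ?_
  · omega
  · exact fun q hq _ => (mem_filter.1 hq).2.one_le

theorem le_theta_100000 : 143815 * Real.log 2 ≤ Chebyshev.theta 100000 := by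
  have h : 2 ^ 143815 * 1 ≤ primorial 100000 := by
    rw [mul_one]
    refine two_pow_le_prod_primes_lt_100000.trans ?_
    refine prod_le_prod_of_subset_of_one_le' (filter_subset_filter _ (range_subset_range.2 ?_)) ?_
    · omega
    · exact fun q hq _ => (mem_filter.1 hq).2.one_le
  simpa only [Nat.cast_one, Nat.cast_ofNat, Real.log_one, add_zero] using
    mul_log_two_add_log_le_theta le_rfl h

theorem le_harmonic {m n : ℕ} (h : m ≤ ∑ i ∈ range (n + 1), 1000000000000 / i) :
    (m : ℝ) / 1000000000000 ≤ (harmonic n : ℚ) := by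
  rw [sum_range_succ', Nat.div_zero, Nat.add_zero] at h
  rw [div_le_iff₀' (by norm_num), harmonic, Rat.cast_sum, mul_sum]
  refine (Nat.cast_le.2 h).trans ?_
  rw [Nat.cast_sum]
  refine sum_le_sum fun i _ => Nat.cast_div_le.trans (le_of_eq ?_)
  push_cast
  rw [div_eq_mul_inv]

theorem le_eulerMascheroniConstant :
    8.894859754428 - Real.log 4096 < Real.eulerMascheroniConstant := by
  have h1 := le_gridSum_div
  rw [gridSum_eq] at h1
  have h2 := le_harmonic (n := 4095) h1
  have h3 := Real.eulerMascheroniSeq_lt_eulerMascheroniConstant 4095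
  rw [Real.eulerMascheroniSeq, show ((4095 : ℕ) : ℝ) + 1 = 4096 by norm_num] at h3
  have h4 : ((8894859754428 : ℕ) : ℝ) / 1000000000000 = 8.894859754428 := by norm_num
  linarith

theorem le_vonMangoldtBase :
    146772976839011 * Real.log 2 ≤ 10240000000000 * vonMangoldtBase := by
  set F : ℕ → ℝ := fun n => ArithmeticFunction.vonMangoldt n * (1 / (n : ℝ) - 1 / 100000) with hF
  obtain ⟨T, hT⟩ : ∃ T : Finset (ℕ × ℕ), T =
      {a ∈ {p ∈ range (250 * 400) | p.Prime} ×ˢ range 16 | a.1 ^ (1 + a.2) ≤ 100000} := ⟨_, rfl⟩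
  have hprime : ∀ a ∈ T, a.1.Prime := fun a ha => by
    rw [hT, mem_filter, mem_product, mem_filter] at ha
    exact ha.1.1.2
  have hle : ∀ a ∈ T, a.1 ^ (1 + a.2) ≤ 100000 := fun a ha => by
    rw [hT, mem_filter] at ha
    exact ha.2
  have hinj : Set.InjOn (fun a : ℕ × ℕ => a.1 ^ (1 + a.2)) (T : Set (ℕ × ℕ)) := by
    rintro ⟨p, i⟩ ha ⟨q, j⟩ hb hab
    simp only [add_comm 1] at hab
    obtain ⟨rfl, rfl⟩ := Nat.Prime.pow_inj (hprime _ ha) (hprime _ hb) hab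
    rfl
  have h1 : ∑ a ∈ T, F (a.1 ^ (1 + a.2)) ≤ vonMangoldtBase := by
    rw [← sum_image (f := F) hinj, vonMangoldtBase]
    refine sum_le_sum_of_subset_of_nonneg (fun n hn => ?_) fun n hn _ => ?_
    · obtain ⟨a, ha, rfl⟩ := mem_image.1 hn
      exact mem_Ioc.2 ⟨pow_pos (hprime a ha).pos _, hle a ha⟩
    · rw [mem_Ioc] at hn
      refine mul_nonneg ArithmeticFunction.vonMangoldt_nonneg (sub_nonneg.2 ?_)
      exact one_div_le_one_div_of_le (by exact_mod_cast hn.1) (by exact_mod_cast hn.2)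
  have h2 : ∀ p : ℕ, p.Prime → ∀ c : ℕ, c * Real.log 2 ≤ (1024 : ℕ) * Real.log p → ∀ i,
      ((c * (10000000000 / Nat.pow p (1 + i) - 100000) : ℕ) : ℝ) * Real.log 2 ≤
        if p ^ (1 + i) ≤ 100000 then 10240000000000 * F (p ^ (1 + i)) else 0 := by
    intro p hp c h3 i
    have hpos : 0 < p ^ (1 + i) := pow_pos hp.pos _
    split_ifs with h
    · have h4 : ((10000000000 / Nat.pow p (1 + i) - 100000 : ℕ) : ℝ) ≤
          10000000000 * (1 / ((p ^ (1 + i) : ℕ) : ℝ) - 1 / 100000) := by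
        have h5 : 100000 ≤ 10000000000 / p ^ (1 + i) := by
          rw [Nat.le_div_iff_mul_le hpos]
          omega
        change ((10000000000 / p ^ (1 + i) - 100000 : ℕ) : ℝ) ≤ _
        rw [Nat.cast_sub h5]
        have h6 : ((10000000000 / p ^ (1 + i) : ℕ) : ℝ) ≤
          (10000000000 : ℕ) / ((p ^ (1 + i) : ℕ) : ℝ) := Nat.cast_div_le
        rw [mul_sub, mul_one_div]
        push_cast at h6 ⊢
        linarith
      have h7 : F (p ^ (1 + i)) =
          Real.log p * (1 / ((p ^ (1 + i) : ℕ) : ℝ) - 1 / 100000) := by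
        simp only [hF]
        rw [ArithmeticFunction.vonMangoldt_apply_pow (by omega),
          ArithmeticFunction.vonMangoldt_apply_prime hp]
      rw [h7, Nat.cast_mul, mul_right_comm]
      refine (mul_le_mul h3 h4 (Nat.cast_nonneg _) ?_).trans
        (le_of_eq (by rw [Nat.cast_ofNat]; ring))
      exact mul_nonneg (Nat.cast_nonneg _) (Real.log_natCast_nonneg p)
    · have h3 : 10000000000 / Nat.pow p (1 + i) ≤ 100000 := by
        change 10000000000 / p ^ (1 + i) ≤ 100000
        refine Nat.div_le_of_le_mul ?_
        omega
      rw [Nat.sub_eq_zero_of_le h3]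
      simp
  have h3 := le_gridSum_log2Below
  rw [← sum_primes_eq_gridSum (fun p => log2Below 15 (Nat.pow p 1024) *
      blockSum (fun k => 10000000000 / Nat.pow p k - 100000) 1 16) (by norm_num)] at h3
  have h4 : ((146772976839011 : ℕ) : ℝ) * Real.log 2 ≤
      10240000000000 * ∑ a ∈ T, F (a.1 ^ (1 + a.2)) := by
    refine (mul_le_mul_of_nonneg_right (Nat.cast_le.2 h3) (Real.log_nonneg one_le_two)).trans ?_
    rw [hT, sum_filter (fun a : ℕ × ℕ => a.1 ^ (1 + a.2) ≤ 100000), sum_product, mul_sum,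
      Nat.cast_sum, sum_mul]
    refine sum_le_sum fun p hp => ?_
    rw [mem_filter] at hp
    rw [blockSum_eq, mul_sum, mul_sum, Nat.cast_sum, sum_mul]
    refine sum_le_sum fun i _ => (h2 p hp.2 _
      (log2Below_mul_log_two_le 15 1024 hp.2.one_le) i).trans (le_of_eq ?_)
    rw [mul_ite, mul_zero]
  push_cast at h4
  linarith

theorem sum_one_div_pow_eq {q : ℝ} (hq : 1 < q) :
    ∑ i ∈ range 7, 1 / q ^ i = (1 - 1 / q ^ 7) * (q / (q - 1)) := by
  have h1 : q - 1 ≠ 0 := by linarith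
  simp only [sum_range_succ, sum_range_zero]
  field_simp
  ring

theorem sum_one_div_pow_le {q : ℝ} (hq : 1 < q) :
    ∑ i ∈ range 7, 1 / q ^ i ≤ q / (q - 1) := by
  have h1 : 0 < q - 1 := by linarith
  rw [sum_one_div_pow_eq hq]
  refine mul_le_of_le_one_left (by positivity) ?_
  have : 0 ≤ 1 / q ^ 7 := by positivity
  linarith

theorem prod_primes_div_sub_one_le :
    ∏ q ∈ range (250 * 400) with q.Prime, (q : ℝ) / (q - 1) ≤ 20.5115929 := by
  have h : ((10000000 * ∏ p ∈ range (250 * 400) with p.Prime, p : ℕ) : ℝ) ≤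
      ((205115929 * ∏ p ∈ range (250 * 400) with p.Prime, (p - 1) : ℕ) : ℝ) :=
    Nat.cast_le.2 prod_primes_le_mul_prod_sub_one
  rw [Nat.cast_mul, Nat.cast_mul, Nat.cast_prod, Nat.cast_prod,
    prod_congr rfl fun q hq => Nat.cast_pred (R := ℝ) (mem_filter.1 hq).2.pos] at h
  rw [prod_div_distrib, div_le_iff₀]
  · push_cast at h
    linarith
  · refine prod_pos fun q hq => sub_pos.2 ?_
    exact_mod_cast (mem_filter.1 hq).2.one_lt

theorem prod_small_primes_le :
    ∏ q ∈ range (250 * 400) with q.Prime, ∑ i ∈ range 7, 1 / (q : ℝ) ^ i ≤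
      20.5115929 * 0.99172 := by
  have h1 : ∀ q ∈ {q ∈ range (250 * 400) | q.Prime}, ∑ i ∈ range 7, 1 / (q : ℝ) ^ i ≤
      (q / (q - 1)) * (if q ∈ ({2, 3, 5, 7} : Finset ℕ) then 1 - 1 / (q : ℝ) ^ 7 else 1) := by
    intro q hq
    have hq1 : (1 : ℝ) < q := by exact_mod_cast (mem_filter.1 hq).2.one_lt
    split_ifs
    · rw [sum_one_div_pow_eq hq1, mul_comm]
    · rw [mul_one]
      exact sum_one_div_pow_le hq1
  have h2 : ({2, 3, 5, 7} : Finset ℕ) ⊆ {q ∈ range (250 * 400) | q.Prime} := by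
    intro q hq
    simp only [mem_insert, mem_singleton] at hq
    rw [mem_filter, mem_range]
    rcases hq with rfl | rfl | rfl | rfl <;> norm_num
  refine (prod_le_prod (fun q _ => sum_nonneg fun i _ => by positivity) h1).trans ?_
  rw [prod_mul_distrib]
  refine mul_le_mul prod_primes_div_sub_one_le ?_ ?_ (by norm_num)
  · rw [prod_ite_mem, inter_eq_right.2 h2]
    simp
    norm_num
  · rw [prod_ite_mem, inter_eq_right.2 h2]
    simp
    norm_num

theorem sum_one_div_mul_sub_one {a N : ℕ} (ha : 1 ≤ a) (h : a ≤ N) :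
    ∑ m ∈ Ioc a N, 1 / ((m : ℝ) * (m - 1)) = 1 / a - 1 / N := by
  induction N, h using Nat.le_induction with
  | base => simp
  | succ N hN ih =>
    have h1 : (0 : ℝ) < a := by exact_mod_cast ha
    have h2 : (0 : ℝ) < N := by exact_mod_cast ha.trans hN
    rw [← insert_Ioc_right_eq_Ioc_add_one (by omega), sum_insert (by simp), ih]
    rw [Nat.cast_add_one, add_sub_cancel_right]
    field_simp
    ring

theorem prod_large_primes_le {N : ℕ} (hN : 100000 ≤ N) :
    ∏ q ∈ Ioc 100000 N with q.Prime, ∑ i ∈ range 7, 1 / (q : ℝ) ^ i ≤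
      Real.exp (∑ q ∈ Ioc 100000 N with q.Prime, 1 / (q : ℝ) + 0.00001) := by
  have h1 : ∀ q ∈ {q ∈ Ioc 100000 N | q.Prime}, ∑ i ∈ range 7, 1 / (q : ℝ) ^ i ≤
      Real.exp (1 / q + 1 / (q * (q - 1))) := by
    intro q hq
    have hq1 : (1 : ℝ) < q := by exact_mod_cast (mem_filter.1 hq).2.one_lt
    have hq2 : 0 < (q : ℝ) - 1 := sub_pos.2 hq1
    refine (sum_one_div_pow_le hq1).trans ((le_of_eq ?_).trans (Real.add_one_le_exp _))
    field_simp
    ring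
  refine (prod_le_prod (fun q _ => sum_nonneg fun i _ => by positivity) h1).trans ?_
  rw [← Real.exp_sum, sum_add_distrib]
  gcongr
  have h2 : ∑ q ∈ Ioc 100000 N with q.Prime, 1 / ((q : ℝ) * (q - 1)) ≤
      ∑ m ∈ Ioc 100000 N, 1 / ((m : ℝ) * (m - 1)) := by
    refine sum_le_sum_of_subset_of_nonneg (filter_subset _ _) fun m hm _ => ?_
    have : (1 : ℝ) ≤ m := by exact_mod_cast (by have := (mem_Ioc.1 hm).1; omega : 1 ≤ m)
    exact one_div_nonneg.2 (mul_nonneg (by linarith) (by linarith))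
  rw [sum_one_div_mul_sub_one (by norm_num) hN] at h2
  have : (0 : ℝ) ≤ 1 / N := by positivity
  refine h2.trans ?_
  rw [Nat.cast_ofNat]
  linarith

/-- An upper bound for the product of the local factors `1 + 1 / q + ⋯ + 1 / q ^ 6`. -/
theorem prod_primes_lt {N : ℕ} (hN : 100000 ≤ N) (hw : 100000 ≤ Chebyshev.theta N) :
    ∏ q ∈ range (N + 1) with q.Prime, ∑ i ∈ range 7, 1 / (q : ℝ) ^ i <
      Real.exp Real.eulerMascheroniConstant * Real.log (Chebyshev.theta N) := by
  have hsplit : {q ∈ range (N + 1) | q.Prime} =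
      {q ∈ range (250 * 400) | q.Prime} ∪ {q ∈ Ioc 100000 N | q.Prime} := by
    ext q
    rw [mem_union, mem_filter, mem_filter, mem_filter, mem_range, mem_range, mem_Ioc]
    have : q = 100000 → ¬ q.Prime := by
      rintro rfl
      norm_num
    constructor
    · rintro ⟨h1, h2⟩
      have h3 : q ≠ 100000 := fun h => this h h2
      by_cases h4 : q < 100000
      · exact Or.inl ⟨h4, h2⟩
      · exact Or.inr ⟨⟨by omega, by omega⟩, h2⟩
    · rintro (⟨h1, h2⟩ | ⟨h1, h2⟩)
      · exact ⟨by omega, h2⟩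
      · exact ⟨by omega, h2⟩
  have hdisj : Disjoint {q ∈ range (250 * 400) | q.Prime} {q ∈ Ioc 100000 N | q.Prime} := by
    rw [disjoint_left]
    intro q h1 h2
    rw [mem_filter, mem_range] at h1
    rw [mem_filter, mem_Ioc] at h2
    omega
  obtain ⟨hL1, hL2⟩ := log_100000_mem
  have hw1 : 0 < Real.log (Chebyshev.theta N) := Real.log_pos (by linarith)
  set E := invLogAddSq 100000 * (Real.log 100000 - 1.504 - vonMangoldtBase) +
    (1 - Chebyshev.theta 100000 / 100000) / Real.log 100000 + 0.00001 with hE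
  have hE1 : E ≤ 0.0073 := by
    have hl1 := Real.log_two_gt_d9
    have hV := le_vonMangoldtBase
    have hth := le_theta_100000
    have h1 : invLogAddSq 100000 ≤ 0.094405 := by
      rw [invLogAddSq]
      have h2 : 1 / Real.log 100000 ≤ 1 / 11.5129 :=
        one_div_le_one_div_of_le (by norm_num) hL1
      have h3 : 1 / Real.log 100000 ^ 2 ≤ 1 / 11.5129 ^ 2 :=
        one_div_le_one_div_of_le (by norm_num) (by gcongr)
      norm_num at h2 h3 ⊢
      linarith
    have h2 : invLogAddSq 100000 * (Real.log 100000 - 1.504 - vonMangoldtBase) ≤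
        0.094405 * 0.07395 := by
      have h3 : 0 ≤ invLogAddSq 100000 := by
        rw [invLogAddSq]
        positivity
      refine (mul_le_mul_of_nonneg_left (b := Real.log 100000 - 1.504 - vonMangoldtBase)
        (c := 0.07395) (by linarith) h3).trans ?_
      linarith
    have h3 : (1 - Chebyshev.theta 100000 / 100000) / Real.log 100000 ≤ 0.0032 / 11.5129 := by
      refine div_le_div₀ (by norm_num) (by linarith) (by norm_num) hL1
    norm_num at h2 h3 ⊢
    linarith
  have hz : Real.log 7238 ≤ 8.8872 := by
    have h1 := log_le_of_pow_le (a := 7238) (k := 16384) (m := 210066) (by norm_num)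
      (le_of_ble (by decide +kernel))
    have := Real.log_two_lt_d9
    push_cast at h1
    linarith
  have h1 : ∏ q ∈ range (N + 1) with q.Prime, ∑ i ∈ range 7, 1 / (q : ℝ) ^ i ≤
      20.5115929 * 0.99172 * (Real.log (Chebyshev.theta N) / Real.log 100000 * Real.exp E) := by
    rw [hsplit, prod_union hdisj]
    refine mul_le_mul prod_small_primes_le ((prod_large_primes_le hN).trans ?_)
      (prod_nonneg fun q _ => sum_nonneg fun i _ => by positivity) (by norm_num)
    rw [← Real.exp_log (div_pos hw1 (by linarith : 0 < Real.log 100000)), ← Real.exp_add,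
      Real.exp_le_exp, Real.log_div hw1.ne' (by linarith)]
    linarith [sum_inv_prime_le hN hw]
  have h2 : 20.5115929 * 0.99172 / Real.log 100000 ≤ 7238 / 4096 := by
    refine (div_le_div_of_nonneg_left (by norm_num) (by norm_num) hL1).trans ?_
    norm_num
  have h3 : 7238 / 4096 * Real.exp E < Real.exp Real.eulerMascheroniConstant := by
    rw [← Real.exp_log (by norm_num : (0 : ℝ) < 7238 / 4096), ← Real.exp_add, Real.exp_lt_exp,
      Real.log_div (by norm_num) (by norm_num)]
    linarith [le_eulerMascheroniConstant]
  calc _ ≤ _ := h1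
    _ = 20.5115929 * 0.99172 / Real.log 100000 * Real.exp E *
        Real.log (Chebyshev.theta N) := by ring
    _ ≤ 7238 / 4096 * Real.exp E * Real.log (Chebyshev.theta N) := by gcongr
    _ < _ := by gcongr

theorem Rt_primorialAt_s13 {n : ℕ} (hn : 1 ≤ n) (t : ℕ) :
    Rt t (primorialAt n) =
      (∏ q ∈ range (nthPrime n + 1) with q.Prime, ∑ i ∈ range t, 1 / (q : ℝ) ^ i) /
        Real.log (Chebyshev.theta (nthPrime n)) := by
  have h1 : (primorialAt n : ℝ) ≠ 0 := by
    rw [primorialAt_eq hn]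
    exact_mod_cast (primorial_pos _).ne'
  rw [Rt, Psi, log_primorialAt hn, mul_div_mul_left _ _ h1, primorialAt_eq hn, primorial,
    Nat.primeFactors_prod fun q hq => (mem_filter.1 hq).2]

theorem lt_zetaNat_seven : 1.00834927717 < zetaNat 7 := by
  have hs : Summable fun k : ℕ => 1 / ((k : ℝ) + 1) ^ 7 := by
    have h := (summable_nat_add_iff 1).2 (Real.summable_one_div_nat_pow.2 (by norm_num : 1 < 7))
    exact_mod_cast h
  refine lt_of_lt_of_le ?_ (hs.sum_le_tsum (range 30) fun k _ => by positivity)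
  simp only [sum_range_succ, sum_range_zero]
  norm_num

theorem exp_two_div_mul_lt {p θ : ℝ} (hp : 111750 ≤ p) (hθ : 111300 ≤ θ) :
    Real.exp (2 / p) * (1 + 1.1253 / (Real.log p * Real.log θ)) < 1.00834927717 := by
  have hl := Real.log_two_gt_d9
  have h1 : 11.62400 ≤ Real.log p := by
    have := Real.log_le_log (by norm_num) hp
    linarith [le_log_111750]
  have h2 : 11.61997 ≤ Real.log θ := by
    have := Real.log_le_log (by norm_num) hθ
    linarith [le_log_111300]
  have h3 : Real.exp (2 / p) ≤ 1.0000178973 := by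
    have h4 : 2 / p ≤ 2 / 111750 := by gcongr
    refine (Real.exp_le_exp.2 h4).trans ?_
    have h5 := Real.exp_bound' (x := 2 / 111750) (by norm_num) (by norm_num) (n := 3) (by norm_num)
    refine h5.trans ?_
    norm_num [sum_range_succ, Nat.factorial]
  have h4 : 1.1253 / (Real.log p * Real.log θ) ≤ 1.1253 / (11.62400 * 11.61997) := by
    gcongr
  have h5 : 0 < Real.log p * Real.log θ := mul_pos (by linarith) (by linarith)
  refine (mul_le_mul h3 (add_le_add_right h4 1) (by positivity) (by norm_num)).trans_lt ?_
  norm_num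

theorem R7_primorial_lt_exp_gamma (n : ℕ) (hn : 10596 ≤ n) :
    Real.exp (2 / (nthPrime n : ℝ)) *
        (1 + 1.1253 / (Real.log (nthPrime n) * Real.log (Real.log (primorialAt n)))) <
      zetaNat 7 ∧
    Rt 7 (primorialAt n) < Real.exp Real.eulerMascheroniConstant := by
  have hn1 : 1 ≤ n := by omega
  have hp := le_nthPrime hn
  have hw : 111300 ≤ Chebyshev.theta (nthPrime n) := by
    refine le_trans ?_ (le_theta_prime (prime_nthPrime n) hp)
    linarith [Real.log_two_gt_d9, le_log_111750]
  refine ⟨?_, ?_⟩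
  · rw [log_primorialAt hn1]
    exact (exp_two_div_mul_lt (by exact_mod_cast hp) hw).trans lt_zetaNat_seven
  · rw [Rt_primorialAt_s13 hn1, div_lt_iff₀ (Real.log_pos (by linarith))]
    exact prod_primes_lt (by omega) (by linarith)
end
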